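/- Let X be the self-repelling random walk with directed edges and weight function w. Fix x ∈ ℝ and h > 0. Then, as A → ∞, sup_{y∈ℝ} | A⁻¹·Λ±_{⌊Ax⌋,⌊Ah⌋}(⌊Ay⌋) − (|x| − |y| + 2h)₊ | → 0 in probability, where (u)₊ := max(u,0). -/

import Mathlib

open MeasureTheory Filter
open scoped BigOperators ENNReal Topology

noncomputable section

/-- The weight function `w` is positive, nondecreasing and satisfies
`lim_{z→∞} (w(z) - w(-z)) > 0`. -/
def GoodWeight (w : ℤ → ℝ) : Prop :=
  (∀ z, 0 < w z) ∧ (∀ z, w z ≤ w (z + 1)) ∧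
    ∃ c > (0 : ℝ), ∀ᶠ z : ℤ in atTop, c ≤ w z - w (-z)

/-- Local time of the path `x` on the oriented edge from `k` to `k+1` up to time `n`. -/
def dirLocP (x : ℕ → ℤ) (n : ℕ) (k : ℤ) : ℕ :=
  ((Finset.range n).filter fun j => x j = k ∧ x (j + 1) = k + 1).card

/-- Local time of the path `x` on the oriented edge from `k` to `k-1` up to time `n`. -/
def dirLocM (x : ℕ → ℤ) (n : ℕ) (k : ℤ) : ℕ :=
  ((Finset.range n).filter fun j => x j = k ∧ x (j + 1) = k - 1).card

/-- The conditional probability, given the past path `x` up to time `n`, that the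
self-repelling walk with weight `w` makes the step `x n → x (n+1)`. -/
def stepProb (w : ℤ → ℝ) (x : ℕ → ℤ) (n : ℕ) : ℝ :=
  let Δ : ℤ := (dirLocP x n (x n) : ℤ) - (dirLocM x n (x n) : ℤ)
  if x (n + 1) = x n + 1 then w (-Δ) / (w Δ + w (-Δ))
  else if x (n + 1) = x n - 1 then w Δ / (w Δ + w (-Δ))
  else 0

/-- `X` is the self-repelling random walk with directed edges and weight function `w`:
it starts at `0` and its cylinder probabilities evolve by the self-repelling
transition probabilities. -/
def IsSRW {Ω : Type*} [MeasurableSpace Ω] (μ : Measure Ω) (w : ℤ → ℝ)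
    (X : ℕ → Ω → ℤ) : Prop :=
  (∀ n, Measurable (X n)) ∧
  μ {ω | X 0 ω = 0} = 1 ∧
  ∀ (n : ℕ) (x : ℕ → ℤ),
    μ {ω | ∀ i ≤ n + 1, X i ω = x i} =
      μ {ω | ∀ i ≤ n, X i ω = x i} * ENNReal.ofReal (stepProb w x n)

/-- Inverse local time `T⁺_{j,r} = min{n ≥ 0 : ℓ⁺(n,j) ≥ r}` of the path `x`. -/
def Tp (x : ℕ → ℤ) (j : ℤ) (r : ℕ) : ℕ := sInf {n | r ≤ dirLocP x n j}

/-- Inverse local time `T⁻_{j,r} = min{n ≥ 0 : ℓ⁻(n,j) ≥ r}` of the path `x`. -/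
def Tm (x : ℕ → ℤ) (j : ℤ) (r : ℕ) : ℕ := sInf {n | r ≤ dirLocM x n j}

/-- `Λ⁺_{j,r}(k) = ℓ⁺(T⁺_{j,r},k) + ℓ⁻(T⁺_{j,r},k+1)`. -/
def LamP (x : ℕ → ℤ) (j : ℤ) (r : ℕ) (k : ℤ) : ℕ :=
  dirLocP x (Tp x j r) k + dirLocM x (Tp x j r) (k + 1)

/-- `Λ⁻_{j,r}(k) = ℓ⁺(T⁻_{j,r},k) + ℓ⁻(T⁻_{j,r},k+1)`. -/
def LamM (x : ℕ → ℤ) (j : ℤ) (r : ℕ) (k : ℤ) : ℕ :=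
  dirLocP x (Tm x j r) k + dirLocM x (Tm x j r) (k + 1)

/-- Leftmost edge `λ⁺_{j,r}` visited before `T⁺_{j,r}`. -/
def lamEdgeP (x : ℕ → ℤ) (j : ℤ) (r : ℕ) : ℤ := sInf {k : ℤ | 0 < LamP x j r k}

/-- Leftmost edge `λ⁻_{j,r}` visited before `T⁻_{j,r}`. -/
def lamEdgeM (x : ℕ → ℤ) (j : ℤ) (r : ℕ) : ℤ := sInf {k : ℤ | 0 < LamM x j r k}

/-- Rightmost edge `ρ⁺_{j,r}` visited before `T⁺_{j,r}`. -/
def rhoEdgeP (x : ℕ → ℤ) (j : ℤ) (r : ℕ) : ℤ := sSup {k : ℤ | 0 < LamP x j r k}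

/-- Rightmost edge `ρ⁻_{j,r}` visited before `T⁻_{j,r}`. -/
def rhoEdgeM (x : ℕ → ℤ) (j : ℤ) (r : ℕ) : ℤ := sSup {k : ℤ | 0 < LamM x j r k}

namespace SelfRepelling

open ProbabilityTheory

/-- The probability of a right step at a site with imbalance `z`. -/
def rightProb (w : ℤ → ℝ) (z : ℤ) : ℝ := w (-z) / (w z + w (-z))

/-- A family of right-step probabilities which is antisymmetric about `1/2` and pushes the
imbalance back towards `0`, uniformly away from `0`. -/
structure Repelling (p : ℤ → ℝ) : Prop where
  pos : ∀ z, 0 < p z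
  neg : ∀ z, p (-z) = 1 - p z
  drift : ∃ δ > (0 : ℝ), ∃ N : ℕ, ∀ z : ℤ, (N : ℤ) ≤ z → p z ≤ 1 / 2 - δ

theorem Repelling.lt_one {p : ℤ → ℝ} (hp : Repelling p) (z : ℤ) : p z < 1 := by
  have h1 := hp.pos (-z)
  have h2 := hp.neg z
  linarith

theorem Repelling.zero {p : ℤ → ℝ} (hp : Repelling p) : p 0 = 1 / 2 := by
  have h2 := hp.neg 0
  simp only [neg_zero] at h2
  linarith

theorem GoodWeight.repelling {w : ℤ → ℝ} (hw : GoodWeight w) : Repelling (rightProb w) := by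
  obtain ⟨hpos, hmono, c, hc, hev⟩ := hw
  have hmono' : Monotone w := monotone_int_of_le_succ hmono
  refine ⟨fun z => ?_, fun z => ?_, ?_⟩
  · have := hpos z
    have := hpos (-z)
    unfold rightProb
    positivity
  · have h1 := hpos z
    have h2 := hpos (-z)
    unfold rightProb
    rw [neg_neg, eq_sub_iff_add_eq, add_comm (w (-z)), ← add_div]
    exact div_self (by positivity)
  · obtain ⟨M, hM⟩ := eventually_atTop.1 hev
    have h0 := hpos 0
    refine ⟨c / (2 * (c + 2 * w 0)), by positivity, M.toNat, fun z hz => ?_⟩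
    have hzM : M ≤ z := by omega
    have h1 := hpos z
    have h2 := hpos (-z)
    have h3 := hM z hzM
    have h4 : w (-z) ≤ w 0 := hmono' (by omega)
    unfold rightProb
    rw [div_le_iff₀ (by positivity)]
    have h5 : (1 / 2 - c / (2 * (c + 2 * w 0))) = w 0 / (c + 2 * w 0) := by
      field_simp
      ring
    rw [h5, div_mul_eq_mul_div, le_div_iff₀ (by positivity)]
    nlinarith

/-- One-step transition operator of the imbalance chain. -/
def stepOp (p : ℤ → ℝ) (f : ℤ → ℝ) (z : ℤ) : ℝ := p z * f (z + 1) + (1 - p z) * f (z - 1)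

theorem stepOp_mono {p : ℤ → ℝ} (hp : Repelling p) {f g : ℤ → ℝ} (h : ∀ z, f z ≤ g z) (z : ℤ) :
    stepOp p f z ≤ stepOp p g z := by
  have h1 := (hp.pos z).le
  have h2 := (hp.lt_one z).le
  have h3 := h (z + 1)
  have h4 := h (z - 1)
  unfold stepOp
  gcongr

theorem stepOp_comp_neg {p : ℤ → ℝ} (hp : Repelling p) (f : ℤ → ℝ) :
    stepOp p (fun z => f (-z)) = fun z => stepOp p f (-z) := by
  ext z
  simp only [stepOp]
  rw [hp.neg z, show -(z + 1) = -z - 1 by ring, show -(z - 1) = -z + 1 by ring]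
  ring

theorem iterate_stepOp_comp_neg {p : ℤ → ℝ} (hp : Repelling p) (m : ℕ) :
    ∀ f : ℤ → ℝ, (stepOp p)^[m] (fun z => f (-z)) = fun z => (stepOp p)^[m] f (-z) := by
  induction m with
  | zero => intro f; rfl
  | succ m ih =>
    intro f
    rw [Function.iterate_succ_apply, stepOp_comp_neg hp, ih]
    rfl

/-- Even functions which are monotone in `|z|` along each parity class. -/
structure EvenMono (f : ℤ → ℝ) : Prop where
  even : ∀ z, f (-z) = f z
  mono : ∀ z, 0 ≤ z → f z ≤ f (z + 2)

theorem EvenMono.stepOp {p : ℤ → ℝ} (hp : Repelling p) {f : ℤ → ℝ} (hf : EvenMono f) :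
    EvenMono (stepOp p f) := by
  have hm : ∀ z, -1 ≤ z → f z ≤ f (z + 2) := by
    intro z hz
    rcases eq_or_lt_of_le hz with h | h
    · subst h
      rw [hf.even 1]; norm_num
    · exact hf.mono z (by omega)
  refine ⟨fun z => ?_, fun z hz => ?_⟩
  · have := congrFun (stepOp_comp_neg hp f) z
    simp only [hf.even] at this
    exact this.symm
  · have h1 := hm (z + 1) (by omega)
    have h2 := hm (z - 1) (by omega)
    have h3 := hp.pos (z + 2)
    have h4 := hp.lt_one z
    unfold SelfRepelling.stepOp
    rw [show z + 1 + 2 = z + 2 + 1 by ring] at h1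
    rw [show z - 1 + 2 = z + 1 by ring] at h2
    rw [show z + 2 - 1 = z + 1 by ring]
    nlinarith

theorem EvenMono.iterate {p : ℤ → ℝ} (hp : Repelling p) (m : ℕ) :
    ∀ {f : ℤ → ℝ}, EvenMono f → EvenMono ((SelfRepelling.stepOp p)^[m] f) := by
  induction m with
  | zero => intro f h; exact h
  | succ m ih => intro f h; exact ih (h.stepOp hp)

theorem EvenMono.iterate_le {p : ℤ → ℝ} (hp : Repelling p) {f : ℤ → ℝ} (hf : EvenMono f) (m : ℕ) :
    (SelfRepelling.stepOp p)^[m] f 0 ≤ (SelfRepelling.stepOp p)^[m + 2] f 0 := by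
  have h := hf.iterate hp m
  have h1 : (SelfRepelling.stepOp p)^[m + 2] f 0 = 
      SelfRepelling.stepOp p (SelfRepelling.stepOp p ((SelfRepelling.stepOp p)^[m] f)) 0 := by
    rw [Function.iterate_succ_apply', Function.iterate_succ_apply']
  rw [h1]
  set g := (SelfRepelling.stepOp p)^[m] f
  have h2 := (h.stepOp hp).even 1
  have h3 : SelfRepelling.stepOp p (SelfRepelling.stepOp p g) 0 = SelfRepelling.stepOp p g 1 := by
    rw [SelfRepelling.stepOp, hp.zero, zero_add, zero_sub, h2]
    ring
  rw [h3]
  have h4 := h.mono 0 le_rfl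
  have h5 := hp.pos 1
  unfold SelfRepelling.stepOp
  norm_num at h4 ⊢
  nlinarith

/-- Geometric Lyapunov bound for the imbalance chain. -/
theorem exists_lyapunov {p : ℤ → ℝ} (hp : Repelling p) :
    ∃ l > (1 : ℝ), ∃ C > (0 : ℝ), ∀ m : ℕ,
      (stepOp p)^[m] (fun z => l ^ z.natAbs) 0 ≤ C := by
  obtain ⟨δ, hδ, N, hN⟩ := hp.drift
  have hδ2 : δ < 1 / 2 := by
    have := hN N le_rfl
    have := hp.pos N
    linarith
  set l : ℝ := 1 + δ with hl
  set g : ℝ := 1 - δ ^ 2 / 2 with hg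
  have hl1 : 1 < l := by linarith
  have hg1 : g < 1 := by
    have : 0 < δ ^ 2 := by positivity
    linarith
  have hg0 : 0 < g := by nlinarith
  have hkey : (1 / 2 - δ) * l + (1 / 2 + δ) * l⁻¹ ≤ g := by
    have hl0 : 0 < l := by linarith
    rw [← sub_nonneg]
    have : g - ((1 / 2 - δ) * l + (1 / 2 + δ) * l⁻¹)
        = (g * l - (1 / 2 - δ) * l ^ 2 - (1 / 2 + δ)) / l := by
      field_simp
      ring
    rw [this]
    apply div_nonneg _ hl0.le
    rw [hg, hl]
    nlinarith [sq_nonneg δ, mul_pos hδ hδ, mul_pos (mul_pos hδ hδ) hδ]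
  set V : ℤ → ℝ := fun z => l ^ z.natAbs with hV
  have hpos : ∀ z : ℤ, (N : ℤ) + 1 ≤ z → stepOp p V z ≤ g * V z := by
    intro z hz
    obtain ⟨n, rfl⟩ : ∃ n : ℕ, z = n + 1 := ⟨(z - 1).toNat, by omega⟩
    have h1 := hN (n + 1) (by omega)
    have e1 : ((n : ℤ) + 1 + 1).natAbs = n + 2 := by omega
    have e2 : ((n : ℤ) + 1 - 1).natAbs = n := by omega
    have e3 : ((n : ℤ) + 1).natAbs = n + 1 := by omega
    simp only [stepOp, hV, e1, e2, e3]
    have hln : 0 < l ^ n := by positivity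
    have hl0 : 0 < l := by linarith
    have h2 : p (n + 1) * l + (1 - p (n + 1)) * l⁻¹ ≤ g := by
      refine le_trans ?_ hkey
      have : l⁻¹ ≤ l := (inv_le_one_of_one_le₀ hl1.le).trans hl1.le
      nlinarith
    have h3 : p (n + 1) * l ^ (n + 2) + (1 - p (n + 1)) * l ^ n
        = (p (n + 1) * l + (1 - p (n + 1)) * l⁻¹) * l ^ (n + 1) := by
      field_simp
      ring
    rw [h3]
    gcongr
  have hev : ∀ z, V (-z) = V z := by intro z; simp [hV]
  have hall : ∀ z : ℤ, stepOp p V z ≤ g * V z + l ^ (N + 1) := by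
    intro z
    have hK : 0 < l ^ (N + 1) := by positivity
    have hVz : 0 < V z := by simp only [hV]; positivity
    by_cases h1 : (N : ℤ) + 1 ≤ z
    · linarith [hpos z h1]
    by_cases h2 : (N : ℤ) + 1 ≤ -z
    · have h3 := hpos (-z) h2
      rw [hev] at h3
      have h4 := congrFun (stepOp_comp_neg hp V) z
      simp only [hev] at h4
      linarith
    · have h5 : V (z + 1) ≤ l ^ (N + 1) := pow_le_pow_right₀ hl1.le (by omega)
      have h6 : V (z - 1) ≤ l ^ (N + 1) := pow_le_pow_right₀ hl1.le (by omega)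
      have h7 := (hp.pos z).le
      have h8 := (hp.lt_one z).le
      have : 0 < g * V z := by positivity
      unfold stepOp
      nlinarith
  have hmain : ∀ m : ℕ, ∀ z, (stepOp p)^[m] V z ≤
      g ^ m * V z + l ^ (N + 1) * ∑ i ∈ Finset.range m, g ^ i := by
    intro m
    induction m with
    | zero => intro z; simp
    | succ m ih =>
      intro z
      rw [Function.iterate_succ_apply']
      refine (stepOp_mono hp ih z).trans ?_
      have h1 : stepOp p (fun z => g ^ m * V z + l ^ (N + 1) * ∑ i ∈ Finset.range m, g ^ i) z
          = g ^ m * stepOp p V z + l ^ (N + 1) * ∑ i ∈ Finset.range m, g ^ i := by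
        unfold stepOp; ring
      rw [h1, Finset.sum_range_succ, pow_succ g m]
      have h2 := mul_le_mul_of_nonneg_left (hall z) (pow_pos hg0 m).le
      linarith
  refine ⟨l, hl1, 1 + l ^ (N + 1) * (1 - g)⁻¹, ?_, fun m => (hmain m 0).trans ?_⟩
  · have : 0 < 1 - g := by linarith
    positivity
  · have h1 : g ^ m ≤ 1 := pow_le_one₀ hg0.le hg1.le
    have h2 : ∑ i ∈ Finset.range m, g ^ i ≤ (1 - g)⁻¹ := by
      rw [← tsum_geometric_of_lt_one hg0.le hg1]
      exact (summable_geometric_of_lt_one hg0.le hg1).sum_le_tsum _ (fun i _ => by positivity)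
    have h3 : V 0 = 1 := by simp [hV]
    rw [h3, mul_one]
    gcongr

/-- The uniform distribution on the unit interval. -/
def unif : Measure ℝ := volume.restrict (Set.Ioo 0 1)

instance : IsProbabilityMeasure unif := ⟨by simp [unif]⟩

theorem unif_Iio {t : ℝ} (h1 : t ≤ 1) : unif (Set.Iio t) = ENNReal.ofReal t := by
  rw [unif, Measure.restrict_apply measurableSet_Iio, Set.inter_comm, Set.Ioo_inter_Iio,
    min_eq_right h1, Real.volume_Ioo, sub_zero]

theorem unif_Ici {t : ℝ} (h0 : 0 ≤ t) (h1 : t ≤ 1) :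
    unif (Set.Ici t) = ENNReal.ofReal (1 - t) := by
  rw [← Set.compl_Iio, prob_compl_eq_one_sub measurableSet_Iio, unif_Iio h1,
    ENNReal.ofReal_sub _ h0, ENNReal.ofReal_one]

theorem integral_unif_ite {t : ℝ} (h0 : 0 ≤ t) (h1 : t ≤ 1) (a b : ℝ) :
    ∫ u, (if u < t then a else b) ∂unif = t * a + (1 - t) * b := by
  have h : ∀ u : ℝ, (if u < t then a else b) = (Set.Iio t).indicator (fun _ => a - b) u + b := by
    intro u
    by_cases hu : u < t <;> simp [hu]
  simp_rw [h]
  rw [integral_add ((integrable_const _).indicator measurableSet_Iio) (integrable_const _),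
    integral_indicator_const _ measurableSet_Iio, measureReal_def, unif_Iio h1,
    ENNReal.toReal_ofReal h0]
  simp
  ring

/-- A function of the first `m` members of an independent sequence is independent of the
`m`-th one. -/
theorem indepFun_initial_segment {Ω β γ : Type*} [MeasurableSpace Ω] [MeasurableSpace β]
    [MeasurableSpace γ] [Inhabited β] {P : Measure Ω} {X : ℕ → Ω → β} (hX : iIndepFun X P)
    (hm : ∀ i, Measurable (X i)) (m : ℕ) {F : (ℕ → β) → γ} (hF : Measurable F)
    (hdep : ∀ x y, (∀ i < m, x i = y i) → F x = F y) :
    IndepFun (fun ω => F (fun i => X i ω)) (X m) P := by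
  have h := hX.indepFun_finset (Finset.range m) {m} (by simp) hm
  let g : ((i : Finset.range m) → β) → γ := fun x =>
    F (fun i => if hi : i ∈ Finset.range m then x ⟨i, hi⟩ else default)
  let k : ((i : ({m} : Finset ℕ)) → β) → β := fun x => x ⟨m, by simp⟩
  have hg : Measurable g := by
    refine hF.comp (measurable_pi_lambda _ fun i => ?_)
    by_cases hi : i ∈ Finset.range m
    · simp only [hi, dite_true]
      exact measurable_pi_apply _
    · simp only [hi, dite_false]
      exact measurable_const
  have hk : Measurable k := measurable_pi_apply _
  have h2 := h.comp hg hk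
  have h3 : (g ∘ fun ω (i : Finset.range m) => X i ω) = fun ω => F (fun i => X i ω) := by
    ext ω
    refine hdep _ _ fun i hi => ?_
    simp [hi]
  rwa [h3] at h2

/-- The number of right steps among the first `m` steps from a site driven by the uniform
variables `v`. -/
def rightCount (p : ℤ → ℝ) (v : ℕ → ℝ) : ℕ → ℕ
  | 0 => 0
  | m + 1 => rightCount p v m + if v m < p (2 * rightCount p v m - m) then 1 else 0

/-- The imbalance (right steps minus left steps) after `m` steps from a site. -/
def imb (p : ℤ → ℝ) (v : ℕ → ℝ) (m : ℕ) : ℤ := 2 * rightCount p v m - m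

theorem rightCount_succ (p : ℤ → ℝ) (v : ℕ → ℝ) (m : ℕ) : rightCount p v (m + 1) =
    rightCount p v m + if v m < p (imb p v m) then 1 else 0 := rfl

theorem rightCount_le (p : ℤ → ℝ) (v : ℕ → ℝ) (m : ℕ) : rightCount p v m ≤ m := by
  induction m with
  | zero => exact le_rfl
  | succ m ih => rw [rightCount_succ]; split_ifs <;> omega

theorem imb_succ (p : ℤ → ℝ) (v : ℕ → ℝ) (m : ℕ) :
    imb p v (m + 1) = if v m < p (imb p v m) then imb p v m + 1 else imb p v m - 1 := by
  conv_lhs => rw [imb, rightCount_succ]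
  split_ifs <;> rw [imb] <;> push_cast <;> ring

theorem natAbs_imb_le (p : ℤ → ℝ) (v : ℕ → ℝ) (m : ℕ) : (imb p v m).natAbs ≤ m := by
  have := rightCount_le p v m
  unfold imb
  omega

theorem rightCount_congr (p : ℤ → ℝ) {v v' : ℕ → ℝ} (m : ℕ) (h : ∀ i < m, v i = v' i) :
    rightCount p v m = rightCount p v' m := by
  induction m with
  | zero => rfl
  | succ m ih =>
    have h1 := ih fun i hi => h i (by omega)
    rw [rightCount_succ, rightCount_succ, imb, imb, h1, h m (by omega)]

theorem measurable_rightCount (p : ℤ → ℝ) (m : ℕ) :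
    Measurable fun v : ℕ → ℝ => rightCount p v m := by
  induction m with
  | zero => exact measurable_const
  | succ m ih =>
    simp only [rightCount_succ, imb]
    refine ih.add (Measurable.ite (measurableSet_lt (measurable_pi_apply m) ?_)
      measurable_const measurable_const)
    exact (measurable_of_countable fun n : ℕ => p (2 * n - m)).comp ih

theorem measurable_imb (p : ℤ → ℝ) (m : ℕ) : Measurable fun v : ℕ → ℝ => imb p v m :=
  (measurable_of_countable fun n : ℕ => (2 * n - m : ℤ)).comp (measurable_rightCount p m)

/-- The law of the uniform variables driving one site. -/
def siteMeasure : Measure (ℕ → ℝ) := Measure.infinitePi fun _ => unif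

instance : IsProbabilityMeasure siteMeasure := by unfold siteMeasure; infer_instance

theorem siteMeasure_map_eval (m : ℕ) : siteMeasure.map (fun v => v m) = unif :=
  Measure.infinitePi_map_eval _ m

theorem integrable_comp_imb (p : ℤ → ℝ) (m : ℕ) (f : ℤ → ℝ) :
    Integrable (fun v => f (imb p v m)) siteMeasure := by
  have hM : Measurable fun v => f (imb p v m) :=
    (measurable_of_countable f).comp (measurable_imb p m)
  refine Integrable.of_bound hM.aestronglyMeasurable
    (∑ z ∈ Finset.Icc (-(m : ℤ)) m, |f z|) (Eventually.of_forall fun v => ?_)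
  have h := natAbs_imb_le p v m
  rw [Real.norm_eq_abs]
  exact Finset.single_le_sum (f := fun z => |f z|) (fun z _ => abs_nonneg _)
    (Finset.mem_Icc.2 (by omega))

theorem integral_comp_imb {p : ℤ → ℝ} (hp : Repelling p) (m : ℕ) : ∀ f : ℤ → ℝ,
    ∫ v, f (imb p v m) ∂siteMeasure = (stepOp p)^[m] f 0 := by
  induction m with
  | zero => intro f; simp [imb, rightCount]
  | succ m ih =>
    intro f
    rw [Function.iterate_succ_apply, ← ih]
    have hind : IndepFun (fun v : ℕ → ℝ => imb p v m) (fun v => v m) siteMeasure := by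
      have hX : iIndepFun (fun (i : ℕ) (v : ℕ → ℝ) => v i) siteMeasure :=
        iIndepFun_infinitePi (fun _ => measurable_id)
      refine indepFun_initial_segment hX (fun i => measurable_pi_apply i) m (measurable_imb p m) ?_
      intro x y h
      simp only [imb, rightCount_congr p m h]
    have hlaw := (indepFun_iff_map_prod_eq_prod_map_map (measurable_imb p m).aemeasurable
      (measurable_pi_apply m).aemeasurable).1 hind
    rw [siteMeasure_map_eval] at hlaw
    let G : ℤ × ℝ → ℝ := fun x => if x.2 < p x.1 then f (x.1 + 1) else f (x.1 - 1)
    have hG : Measurable G := by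
      refine Measurable.ite (measurableSet_lt measurable_snd ?_) ?_ ?_
      · exact (measurable_of_countable p).comp measurable_fst
      · exact (measurable_of_countable fun z => f (z + 1)).comp measurable_fst
      · exact (measurable_of_countable fun z => f (z - 1)).comp measurable_fst
    have hmeas : Measurable fun v : ℕ → ℝ => (imb p v m, v m) :=
      (measurable_imb p m).prodMk (measurable_pi_apply m)
    have h1 : ∀ v, f (imb p v (m + 1)) = G (imb p v m, v m) := by
      intro v
      rw [imb_succ]
      simp only [G]
      split_ifs <;> rfl
    have hint : Integrable G ((siteMeasure.map fun v => imb p v m).prod unif) := by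
      rw [← hlaw, integrable_map_measure hG.aestronglyMeasurable hmeas.aemeasurable]
      exact (integrable_comp_imb p (m + 1) f).congr (Eventually.of_forall h1)
    simp_rw [h1]
    rw [← integral_map (f := G) hmeas.aemeasurable hG.aestronglyMeasurable, hlaw,
      integral_prod _ hint]
    have h2 : ∀ z : ℤ, ∫ u, G (z, u) ∂unif = stepOp p f z := fun z =>
      
      integral_unif_ite (hp.pos z).le (hp.lt_one z).le (f (z + 1)) (f (z - 1))
    simp_rw [h2]
    exact integral_map (measurable_imb p m).aemeasurable
      (measurable_of_countable _).aestronglyMeasurable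

/-- Upper tail of the imbalance after `m` steps. -/
def tail (p : ℤ → ℝ) (m : ℕ) (d : ℤ) : ℝ := siteMeasure.real {v | d ≤ imb p v m}

theorem measurableSet_imb (p : ℤ → ℝ) (m : ℕ) (s : Set ℤ) :
    MeasurableSet {v | imb p v m ∈ s} := measurable_imb p m (MeasurableSet.of_discrete)

theorem measureReal_imb {p : ℤ → ℝ} (hp : Repelling p) (m : ℕ) (s : Set ℤ) :
    siteMeasure.real {v | imb p v m ∈ s} = (stepOp p)^[m] (s.indicator 1) 0 := by
  rw [← integral_comp_imb hp, ← integral_indicator_one (measurableSet_imb p m s)]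
  rfl

theorem measureReal_imb_neg {p : ℤ → ℝ} (hp : Repelling p) (m : ℕ) (d : ℤ) :
    siteMeasure.real {v | imb p v m ≤ -d} = tail p m d := by
  have h1 := measureReal_imb hp m (Set.Iic (-d))
  have h2 := measureReal_imb hp m (Set.Ici d)
  have h3 := congrFun (iterate_stepOp_comp_neg hp m ((Set.Ici d).indicator 1)) 0
  have h4 : (fun z => (Set.Ici d).indicator (1 : ℤ → ℝ) (-z)) = (Set.Iic (-d)).indicator 1 := by
    ext z
    simp [Set.indicator, le_neg]
  rw [h4, neg_zero] at h3
  simp only [Set.mem_Iic, Set.mem_Ici] at h1 h2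
  rw [h1, h3, ← h2]
  rfl

theorem tail_nonneg (p : ℤ → ℝ) (m : ℕ) (d : ℤ) : 0 ≤ tail p m d := measureReal_nonneg

theorem tail_le_add_two {p : ℤ → ℝ} (hp : Repelling p) (m : ℕ) {d : ℤ} (hd : 1 ≤ d) :
    tail p m d ≤ tail p (m + 2) d := by
  have hf : EvenMono ({z : ℤ | d ≤ z ∨ z ≤ -d}.indicator (1 : ℤ → ℝ)) := by
    refine ⟨fun z => ?_, fun z hz => ?_⟩
    · have : d ≤ -z ∨ -z ≤ -d ↔ d ≤ z ∨ z ≤ -d := by omega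
      simp only [Set.indicator, Set.mem_ofPred_eq, this, Pi.one_apply]
    · have : d ≤ z ∨ z ≤ -d → d ≤ z + 2 ∨ z + 2 ≤ -d := by omega
      simp only [Set.indicator, Set.mem_ofPred_eq, Pi.one_apply]
      split_ifs <;> simp_all
  have key : ∀ m, siteMeasure.real {v | imb p v m ∈ {z : ℤ | d ≤ z ∨ z ≤ -d}}
      = 2 * tail p m d := by
    intro m
    have h : {v | imb p v m ∈ {z : ℤ | d ≤ z ∨ z ≤ -d}}
        = {v | d ≤ imb p v m} ∪ {v | imb p v m ≤ -d} := rfl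
    rw [h, measureReal_union (s₂ := {v | imb p v m ≤ -d}) _
      (measurableSet_imb p m (Set.Iic (-d))), measureReal_imb_neg hp]
    · rw [tail]; ring
    · rw [Set.disjoint_left]
      intro v h1 h2
      simp only [Set.mem_ofPred_eq] at h1 h2
      omega
  have h1 := hf.iterate_le hp m
  rw [← measureReal_imb hp, ← measureReal_imb hp, key, key] at h1
  linarith

theorem exists_tail_le {p : ℤ → ℝ} (hp : Repelling p) :
    ∃ l > (1 : ℝ), ∃ C > (0 : ℝ), ∀ (m : ℕ) (d : ℕ), tail p m d ≤ C * l⁻¹ ^ d := by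
  obtain ⟨l, hl, C, hC, h⟩ := exists_lyapunov hp
  refine ⟨l, hl, C, hC, fun m d => ?_⟩
  have h1 := h m
  rw [← integral_comp_imb hp] at h1
  have h2 := mul_meas_ge_le_integral_of_nonneg (μ := siteMeasure)
    (f := fun v => l ^ (imb p v m).natAbs) (Eventually.of_forall fun v => by positivity)
    (integrable_comp_imb p m fun z => l ^ z.natAbs) (l ^ d)
  have h3 : tail p m d ≤ siteMeasure.real {v | l ^ d ≤ l ^ (imb p v m).natAbs} := by
    refine measureReal_mono (fun v hv => ?_)
    simp only [Set.mem_ofPred_eq] at hv ⊢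
    exact pow_le_pow_right₀ hl.le (by omega)
  have h4 : l ^ d * tail p m d ≤ C := by
    refine le_trans ?_ (h2.trans h1)
    gcongr
  rw [inv_pow, ← div_eq_mul_inv, le_div_iff₀ (by positivity)]
  linarith

theorem measurable_sInf_nat {α : Type*} [MeasurableSpace α] {Q : α → ℕ → Prop}
    (hQ : ∀ m, MeasurableSet {x | Q x m}) : Measurable fun x => sInf {m | Q x m} := by
  refine measurable_to_countable' fun k => ?_
  have h : (fun x => sInf {m | Q x m}) ⁻¹' {k} =
      {x | (Q x k ∧ ∀ m, m < k → ¬ Q x m) ∨ (k = 0 ∧ ∀ m, ¬ Q x m)} := by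
    ext x
    simp only [Set.mem_preimage, Set.mem_singleton_iff, Set.mem_ofPred_eq]
    constructor
    · rintro rfl
      by_cases hne : {m | Q x m}.Nonempty
      · exact Or.inl ⟨Nat.sInf_mem hne, fun m hm => Nat.notMem_of_lt_sInf hm⟩
      · rw [Set.not_nonempty_iff_eq_empty] at hne
        refine Or.inr ⟨by rw [hne, Nat.sInf_empty], fun m hm => ?_⟩
        exact (Set.eq_empty_iff_forall_notMem.1 hne) m hm
    · rintro (⟨h1, h2⟩ | ⟨rfl, h⟩)
      · refine le_antisymm (Nat.sInf_le h1) (not_lt.1 fun hlt => h2 _ hlt ?_)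
        exact Nat.sInf_mem (s := {m | Q x m}) ⟨k, h1⟩
      · have : {m | Q x m} = ∅ := Set.eq_empty_iff_forall_notMem.2 h
        rw [this, Nat.sInf_empty]
  rw [h]
  exact measurableSet_setOfPred.2 (((measurableSet_setOfPred.1 (hQ k)).and (Measurable.forall fun m =>
    measurable_const.imp (measurableSet_setOfPred.1 (hQ m)).not)).or (measurable_const.and
    (Measurable.forall fun m => (measurableSet_setOfPred.1 (hQ m)).not)))

/-- A counting function: it starts at `0` and has increments in `{0, 1}`. -/
structure Counting (c : ℕ → ℕ) : Prop where
  zero : c 0 = 0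
  le_succ : ∀ m, c m ≤ c (m + 1)
  succ_le : ∀ m, c (m + 1) ≤ c m + 1

/-- First time at which the counting function `c` reaches level `n`. -/
def hit (c : ℕ → ℕ) (n : ℕ) : ℕ := sInf {m | n ≤ c m}

/-- The number of steps not counted by `c` before `c` reaches level `n`. -/
def other (c : ℕ → ℕ) (n : ℕ) : ℕ := hit c n - n

namespace Counting

variable {c : ℕ → ℕ}

theorem mono (hc : Counting c) : Monotone c := monotone_nat_of_le_succ hc.le_succ

theorem le_self (hc : Counting c) (m : ℕ) : c m ≤ m := by
  induction m with
  | zero => exact hc.zero.le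
  | succ m ih => have := hc.succ_le m; omega

theorem apply_hit (hc : Counting c) {n : ℕ} (hn : ∃ m, n ≤ c m) : c (hit c n) = n := by
  have h1 : n ≤ c (hit c n) := Nat.sInf_mem (s := {m | n ≤ c m}) hn
  refine le_antisymm ?_ h1
  rcases Nat.eq_zero_or_pos (hit c n) with h | h
  · rw [h, hc.zero]; exact Nat.zero_le _
  · have h2 : ¬ n ≤ c (hit c n - 1) := Nat.notMem_of_lt_sInf (s := {m | n ≤ c m})
      (Nat.sub_lt h one_pos)
    have h3 := hc.succ_le (hit c n - 1)
    rw [Nat.sub_add_cancel h] at h3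
    omega

theorem hit_le_iff (hc : Counting c) {n : ℕ} (hn : ∃ m, n ≤ c m) (m : ℕ) :
    hit c n ≤ m ↔ n ≤ c m := by
  refine ⟨fun h => ?_, fun h => Nat.sInf_le h⟩
  rw [← hc.apply_hit hn]
  exact hc.mono h

theorem le_hit (hc : Counting c) {n : ℕ} (hn : ∃ m, n ≤ c m) : n ≤ hit c n := by
  conv_lhs => rw [← hc.apply_hit hn]
  exact hc.le_self _

theorem hit_eq (hc : Counting c) {n : ℕ} (hn : ∃ m, n ≤ c m) : hit c n = n + other c n := by
  have := hc.le_hit hn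
  unfold other
  omega

theorem lt_other_iff (hc : Counting c) {n : ℕ} (hn : ∃ m, n ≤ c m) (t : ℕ) :
    t < other c n ↔ c (n + t) < n := by
  have h1 := hc.hit_le_iff hn (n + t)
  have h2 := hc.hit_eq hn
  omega

end Counting

theorem other_zero (c : ℕ → ℕ) : other c 0 = 0 := by
  simp [other, hit]

/-- The number of left steps among the first `m` steps from a site. -/
def leftCount (p : ℤ → ℝ) (v : ℕ → ℝ) (m : ℕ) : ℕ := m - rightCount p v m

theorem counting_rightCount (p : ℤ → ℝ) (v : ℕ → ℝ) : Counting (rightCount p v) := by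
  refine ⟨rfl, fun m => ?_, fun m => ?_⟩ <;> rw [rightCount_succ] <;> split_ifs <;> omega

theorem counting_leftCount (p : ℤ → ℝ) (v : ℕ → ℝ) : Counting (leftCount p v) := by
  refine ⟨rfl, fun m => ?_, fun m => ?_⟩ <;> have := rightCount_le p v m <;>
    rw [leftCount, leftCount, rightCount_succ] <;> split_ifs <;> omega

/-- Random counting functions at a site with the same one-dimensional laws as the left and
right step counts. -/
structure SiteCount (p : ℤ → ℝ) (c : (ℕ → ℝ) → ℕ → ℕ) : Prop where
  counting : ∀ v, Counting (c v)
  measurable : ∀ m, Measurable fun v => c v m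
  law : ∀ m n : ℕ, siteMeasure.real {v | c v m < n} = tail p m (m - 2 * n + 1)

theorem siteCount_left (p : ℤ → ℝ) : SiteCount p (leftCount p) := by
  refine ⟨counting_leftCount p, fun m => measurable_const.sub (measurable_rightCount p m),
    fun m n => ?_⟩
  rw [tail]
  congr 1
  ext v
  have := rightCount_le p v m
  simp only [Set.mem_ofPred_eq, leftCount, imb]
  omega

theorem siteCount_right {p : ℤ → ℝ} (hp : Repelling p) : SiteCount p (rightCount p) := by
  refine ⟨counting_rightCount p, measurable_rightCount p, fun m n => ?_⟩
  rw [← measureReal_imb_neg hp]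
  congr 1
  ext v
  have := rightCount_le p v m
  simp only [Set.mem_ofPred_eq, imb]
  omega

theorem tail_le_one (p : ℤ → ℝ) (m : ℕ) (d : ℤ) : tail p m d ≤ 1 := measureReal_le_one

theorem one_sub_tail {p : ℤ → ℝ} (hp : Repelling p) (m : ℕ) (d : ℤ) :
    1 - tail p m (-d) = tail p m (d + 1) := by
  rw [← measureReal_imb_neg hp m (d + 1), tail]
  have h := probReal_compl_eq_one_sub (μ := siteMeasure) (measurableSet_imb p m (Set.Ici (-d)))
  have h2 : {v | imb p v m ∈ Set.Ici (-d)}ᶜ = {v | imb p v m ≤ -(d + 1)} := by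
    ext v
    simp only [Set.mem_compl_iff, Set.mem_ofPred_eq, Set.mem_Ici]
    omega
  rw [h2] at h
  rw [h]
  rfl

theorem tail_parity (p : ℤ → ℝ) {m : ℕ} {d : ℤ} (h : (m - d) % 2 = 0) :
    tail p m (d + 1) = tail p m (d + 2) := by
  unfold tail
  congr 1
  ext v
  simp only [Set.mem_ofPred_eq, imb]
  omega

theorem tail_self_pos {p : ℤ → ℝ} (hp : Repelling p) (n : ℕ) : 0 < tail p n n := by
  have h1 : ∀ m : ℕ, ∀ z : ℤ, 0 ≤ (stepOp p)^[m] ((Set.Ici (n : ℤ)).indicator 1) z ∧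
      ((n : ℤ) ≤ z + m → 0 < (stepOp p)^[m] ((Set.Ici (n : ℤ)).indicator 1) z) := by
    intro m
    induction m with
    | zero =>
      intro z
      refine ⟨Set.indicator_nonneg (fun _ _ => zero_le_one) _, fun h => ?_⟩
      have : z ∈ Set.Ici (n : ℤ) := by simpa using h
      simp [Set.indicator_of_mem this]
    | succ m ih =>
      intro z
      rw [Function.iterate_succ_apply', stepOp]
      have h2 := hp.pos z
      have h3 : 0 < 1 - p z := by linarith [hp.lt_one z]
      have h4 := (ih (z + 1)).1
      have h5 := (ih (z - 1)).1
      refine ⟨by positivity, fun h => ?_⟩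
      have h6 := (ih (z + 1)).2 (by push_cast at h; omega)
      positivity
  have h2 := measureReal_imb hp n (Set.Ici (n : ℤ))
  have h3 := (h1 n 0).2 (by omega)
  rw [← h2] at h3
  exact h3

theorem SiteCount.ae_unbounded {p : ℤ → ℝ} (hp : Repelling p) {c : (ℕ → ℝ) → ℕ → ℕ}
    (hc : SiteCount p c) : ∀ᵐ v ∂siteMeasure, ∀ n, ∃ m, n ≤ c v m := by
  rw [ae_all_iff]
  intro n
  obtain ⟨l, hl, C, hC, h⟩ := exists_tail_le hp
  have h1 : ∀ t : ℕ, siteMeasure.real {v | ¬ ∃ m, n ≤ c v m} ≤ C * l⁻¹ ^ t := by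
    intro t
    have h2 := hc.law (2 * n + t) n
    have h3 := h (2 * n + t) (t + 1)
    have h4 : ((2 * n + t : ℕ) : ℤ) - 2 * n + 1 = ((t + 1 : ℕ) : ℤ) := by push_cast; ring
    rw [h4] at h2
    have hl' : l⁻¹ ≤ 1 := inv_le_one_of_one_le₀ hl.le
    have h5 : l⁻¹ ^ (t + 1) ≤ l⁻¹ ^ t :=
      pow_le_pow_of_le_one (by positivity) hl' (by omega)
    calc siteMeasure.real {v | ¬ ∃ m, n ≤ c v m}
        ≤ siteMeasure.real {v | c v (2 * n + t) < n} := by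
          refine measureReal_mono fun v hv => ?_
          simp only [not_exists, not_le, Set.mem_ofPred_eq] at hv ⊢
          exact hv _
      _ ≤ C * l⁻¹ ^ (t + 1) := h2.trans_le h3
      _ ≤ C * l⁻¹ ^ t := by gcongr
  have h2 : Tendsto (fun t : ℕ => C * l⁻¹ ^ t) atTop (𝓝 (C * 0)) :=
    (tendsto_pow_atTop_nhds_zero_of_lt_one (by positivity) (inv_lt_one_of_one_lt₀ hl)).const_mul C
  rw [mul_zero] at h2
  have h3 : siteMeasure.real {v | ¬ ∃ m, n ≤ c v m} = 0 :=
    le_antisymm (ge_of_tendsto' h2 h1) measureReal_nonneg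
  rw [ae_iff]
  exact (measureReal_eq_zero_iff).1 h3

theorem SiteCount.measurable_other {p : ℤ → ℝ} {c : (ℕ → ℝ) → ℕ → ℕ} (hc : SiteCount p c) :
    Measurable fun v => other (c v) := by
  refine measurable_pi_lambda _ fun n => ?_
  exact (measurable_sInf_nat fun m => measurableSet_le measurable_const (hc.measurable m)).sub
    measurable_const

theorem SiteCount.measureReal_lt_other {p : ℤ → ℝ} (hp : Repelling p) {c : (ℕ → ℝ) → ℕ → ℕ}
    (hc : SiteCount p c) (n t : ℕ) :
    siteMeasure.real {v | t < other (c v) n} = tail p (n + t) (t - n + 1) := by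
  have h : siteMeasure.real {v | c v (n + t) < n} = tail p (n + t) (t - n + 1) := by
    rw [hc.law]
    congr 1
    push_cast
    ring
  rw [← h]
  refine measureReal_congr ?_
  filter_upwards [hc.ae_unbounded hp] with v hv
  exact propext ((hc.counting v).lt_other_iff (hv n) t)

theorem exp_moment_of_tail {Ω : Type*} [MeasurableSpace Ω] {P : Measure Ω}
    [IsProbabilityMeasure P] {a : Ω → ℕ} (ha : Measurable a) {b D : ℝ} (hb : 1 < b)
    (htail : ∀ k : ℕ, P.real {ω | k ≤ a ω} ≤ D * (b * b)⁻¹ ^ k) :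
    Integrable (fun ω => b ^ a ω) P ∧ ∫ ω, b ^ a ω ∂P ≤ D * (1 - b⁻¹)⁻¹ := by
  have hb0 : 0 < b := by linarith
  have hb1 : b⁻¹ < 1 := inv_lt_one_of_one_lt₀ hb
  have hm : Measurable fun ω => b ^ a ω := (measurable_of_countable fun n : ℕ => b ^ n).comp ha
  have hms : ∀ k : ℕ, MeasurableSet {ω | k ≤ a ω} := fun k =>
    measurableSet_le measurable_const ha
  have hsum : HasSum (fun k : ℕ => D * b⁻¹ ^ k) (D * (1 - b⁻¹)⁻¹) :=
    (hasSum_geometric_of_lt_one (by positivity) hb1).mul_left D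
  have hD : 0 ≤ D := by
    have := htail 0
    have h2 : (0 : ℝ) ≤ P.real {ω | 0 ≤ a ω} := measureReal_nonneg
    simp only [pow_zero, mul_one] at this
    linarith
  have h1 : ∫⁻ ω, ENNReal.ofReal (b ^ a ω) ∂P ≤ ENNReal.ofReal (D * (1 - b⁻¹)⁻¹) := by
    calc ∫⁻ ω, ENNReal.ofReal (b ^ a ω) ∂P
        ≤ ∫⁻ ω, ∑' k : ℕ, {ω | k ≤ a ω}.indicator (fun _ => ENNReal.ofReal (b ^ k)) ω ∂P := by
          refine lintegral_mono fun ω => ?_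
          refine le_trans (le_of_eq ?_) (ENNReal.le_tsum (a ω))
          rw [Set.indicator_of_mem]
          exact le_refl (a ω)
      _ = ∑' k : ℕ, ENNReal.ofReal (b ^ k) * P {ω | k ≤ a ω} := by
          rw [lintegral_tsum fun k => (measurable_const.indicator (hms k)).aemeasurable]
          exact tsum_congr fun k => lintegral_indicator_const (hms k) _
      _ ≤ ∑' k : ℕ, ENNReal.ofReal (D * b⁻¹ ^ k) := by
          refine ENNReal.tsum_le_tsum fun k => ?_
          rw [← ofReal_measureReal, ← ENNReal.ofReal_mul (by positivity)]
          refine ENNReal.ofReal_le_ofReal ?_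
          calc b ^ k * P.real {ω | k ≤ a ω} ≤ b ^ k * (D * (b * b)⁻¹ ^ k) := by
                gcongr; exact htail k
            _ = D * b⁻¹ ^ k := by
                rw [mul_inv, mul_pow, inv_pow]
                field_simp
      _ = ENNReal.ofReal (D * (1 - b⁻¹)⁻¹) := by
          rw [← hsum.tsum_eq, ENNReal.ofReal_tsum_of_nonneg (fun k => by positivity) hsum.summable]
  have h0 : 0 ≤ᵐ[P] fun ω => b ^ a ω := ae_of_all _ fun ω => by positivity
  have hne : ∫⁻ ω, ENNReal.ofReal (b ^ a ω) ∂P ≠ ∞ := ne_top_of_le_ne_top ENNReal.ofReal_ne_top h1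
  refine ⟨(lintegral_ofReal_ne_top_iff_integrable hm.aestronglyMeasurable h0).1 hne, ?_⟩
  rw [integral_eq_lintegral_of_nonneg_ae h0 hm.aestronglyMeasurable]
  refine ENNReal.toReal_le_of_le_ofReal ?_ h1
  have : 0 < 1 - b⁻¹ := by linarith
  positivity

theorem integral_nat_eq_tsum {Ω : Type*} [MeasurableSpace Ω] {P : Measure Ω}
    [IsProbabilityMeasure P] {a : Ω → ℕ} (ha : Measurable a) :
    ∫ ω, (a ω : ℝ) ∂P = ∑' t : ℕ, P.real {ω | t < a ω} := by
  have hms : ∀ k : ℕ, MeasurableSet {ω | k < a ω} := fun k =>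
    measurableSet_lt measurable_const ha
  have h : ∀ ω, ENNReal.ofReal (a ω : ℝ) =
      ∑' k : ℕ, {ω | k < a ω}.indicator (fun _ => (1 : ℝ≥0∞)) ω := by
    intro ω
    rw [tsum_eq_sum (s := Finset.range (a ω))]
    · rw [Finset.sum_congr rfl (g := fun _ => 1)]
      · simp
      · intro k hk
        exact Set.indicator_of_mem (s := {ω | k < a ω}) (Finset.mem_range.1 hk) _
    · intro k hk
      exact Set.indicator_of_notMem (s := {ω | k < a ω}) (fun h => hk (Finset.mem_range.2 h)) _
  rw [integral_eq_lintegral_of_nonneg_ae (ae_of_all _ fun ω => Nat.cast_nonneg _)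
    ((measurable_of_countable fun n : ℕ => (n : ℝ)).comp ha).aestronglyMeasurable,
    lintegral_congr h, lintegral_tsum fun k => (measurable_const.indicator (hms k)).aemeasurable]
  rw [ENNReal.tsum_toReal_eq]
  · refine tsum_congr fun k => ?_
    rw [lintegral_indicator_const (hms k), one_mul]
    rfl
  · intro k
    rw [lintegral_indicator_const (hms k), one_mul]
    exact measure_ne_top _ _

/-- Uniform quantitative information on the law of a random map `n ↦ Q n`: exponential moments
of `Q n - n`, its mean `e n`, and a lower bound for the probability of reaching `0`. -/
structure SiteLaw {Ω : Type*} [MeasurableSpace Ω] (P : Measure Ω) (θ C : ℝ) (e c₀ : ℕ → ℝ)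
    (Q : Ω → ℕ → ℕ) : Prop where
  meas : Measurable Q
  zero : ∀ ω, Q ω 0 = 0
  exp_int : ∀ n, Integrable (fun ω => Real.exp (θ * |(Q ω n : ℝ) - n|)) P
  exp_le : ∀ n, ∫ ω, Real.exp (θ * |(Q ω n : ℝ) - n|) ∂P ≤ C
  mean : ∀ n, ∫ ω, ((Q ω n : ℝ) - n) ∂P = e n
  ext : ∀ n, c₀ n ≤ P.real {ω | Q ω n = 0}

theorem SiteLaw.comp {Ω Ω' : Type*} [MeasurableSpace Ω] [MeasurableSpace Ω'] {P : Measure Ω}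
    {P' : Measure Ω'} {θ C : ℝ} {e c₀ : ℕ → ℝ} {Q : Ω → ℕ → ℕ} (hQ : SiteLaw P θ C e c₀ Q)
    {g : Ω' → Ω} (hg : MeasurePreserving g P' P) :
    SiteLaw P' θ C e c₀ fun ω => Q (g ω) := by
  have hm : ∀ (n : ℕ) (F : ℕ → ℝ), AEStronglyMeasurable (fun ω => F (Q ω n)) P := fun n F =>
    ((measurable_of_countable F).comp ((measurable_pi_apply n).comp hQ.meas)).aestronglyMeasurable
  have hi : ∀ (n : ℕ) (F : ℕ → ℝ), ∫ ω, F (Q (g ω) n) ∂P' = ∫ ω, F (Q ω n) ∂P := fun n F => by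
    rw [← hg.map_eq, integral_map hg.measurable.aemeasurable]
    rw [hg.map_eq]
    exact hm n F
  refine ⟨hQ.meas.comp hg.measurable, fun ω => hQ.zero _, fun n => ?_, fun n => ?_, fun n => ?_,
    fun n => ?_⟩
  · exact (hg.integrable_comp (hm n fun k => Real.exp (θ * |(k : ℝ) - n|))).2 (hQ.exp_int n)
  · rw [hi n fun k => Real.exp (θ * |(k : ℝ) - n|)]
    exact hQ.exp_le n
  · rw [hi n fun k => (k : ℝ) - n]
    exact hQ.mean n
  · have h : MeasurableSet {ω | Q ω n = 0} :=
      ((measurable_pi_apply n).comp hQ.meas) (measurableSet_singleton 0)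
    rw [show {ω | Q (g ω) n = 0} = g ⁻¹' {ω | Q ω n = 0} from rfl, measureReal_def,
      hg.measure_preimage h.nullMeasurableSet]
    exact hQ.ext n

theorem SiteLaw.integrable {Ω : Type*} [MeasurableSpace Ω] {P : Measure Ω}
    [IsProbabilityMeasure P] {θ C : ℝ} (hθ : 0 < θ) {e c₀ : ℕ → ℝ} {Q : Ω → ℕ → ℕ}
    (hQ : SiteLaw P θ C e c₀ Q) (n : ℕ) : Integrable (fun ω => (Q ω n : ℝ)) P := by
  have hm : Measurable fun ω => (Q ω n : ℝ) :=
    (measurable_of_countable fun n : ℕ => (n : ℝ)).comp ((measurable_pi_apply n).comp hQ.meas)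
  refine Integrable.mono' (((hQ.exp_int n).const_mul θ⁻¹).add (integrable_const (n : ℝ)))
    hm.aestronglyMeasurable (ae_of_all _ fun ω => ?_)
  have h1 := Real.add_one_le_exp (θ * |(Q ω n : ℝ) - n|)
  have h2 : |(Q ω n : ℝ) - n| ≤ θ⁻¹ * Real.exp (θ * |(Q ω n : ℝ) - n|) := by
    rw [← div_eq_inv_mul, le_div_iff₀ hθ]
    linarith
  have h3 := le_abs_self ((Q ω n : ℝ) - n)
  rw [Real.norm_of_nonneg (Nat.cast_nonneg _)]
  show (Q ω n : ℝ) ≤ θ⁻¹ * Real.exp (θ * |(Q ω n : ℝ) - n|) + n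
  linarith

/-- The mean displacement of the map `n ↦ other c n`. -/
def meanShift (p : ℤ → ℝ) (n : ℕ) : ℝ := ∑' t : ℕ, tail p (n + t) (t - n + 1) - n

theorem summable_tail {p : ℤ → ℝ} (hp : Repelling p) (n k a : ℕ) :
    Summable fun s : ℕ => tail p (n + s) ((s : ℤ) + k + a) := by
  obtain ⟨l, hl, C, hC, h⟩ := exists_tail_le hp
  refine Summable.of_nonneg_of_le (fun s => tail_nonneg _ _ _) (fun s => ?_)
    ((summable_geometric_of_lt_one (r := l⁻¹) (by positivity)
      (inv_lt_one_of_one_lt₀ hl)).mul_left C)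
  refine (h (n + s) (s + k + a)).trans ?_ |>.trans' (by push_cast; rfl)
  gcongr ?_ * ?_
  exact pow_le_pow_of_le_one (by positivity) (inv_le_one_of_one_le₀ hl.le) (by omega)

theorem meanShift_succ {p : ℤ → ℝ} (hp : Repelling p) (n : ℕ) :
    meanShift p (n + 1) = -1 / 2 + ∑' s : ℕ, (tail p (2 * n + 2 + s) (s + 2) -
      if s < n then tail p (2 * n - s) (s + 2) else 0) := by
  have hS : Summable fun s : ℕ => tail p (2 * n + 2 + s) ((s : ℤ) + 2) := by
    simpa using summable_tail hp (2 * n + 2) 2 0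
  have h1 : (fun s : ℕ => tail p (n + 1 + (s + (n + 1))) (((s + (n + 1) : ℕ) : ℤ) - (n + 1 : ℕ) + 1)) =
      fun s : ℕ => tail p (2 * n + 2 + s) ((s : ℤ) + 2) := by
    ext s
    rw [show n + 1 + (s + (n + 1)) = 2 * n + 2 + s by ring,
      show ((s + (n + 1) : ℕ) : ℤ) - (n + 1 : ℕ) + 1 = s + 1 by push_cast; ring]
    exact tail_parity p (by push_cast; omega)
  have h2 : Summable fun t : ℕ => tail p (n + 1 + t) ((t : ℤ) - (n + 1 : ℕ) + 1) := by
    rw [← summable_nat_add_iff (n + 1), h1]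
    exact hS
  have h3 : ∑ t ∈ Finset.range (n + 1), tail p (n + 1 + t) ((t : ℤ) - (n + 1 : ℕ) + 1) =
      n + 1 - 1 / 2 - ∑ s ∈ Finset.range n, tail p (2 * n - s) ((s : ℤ) + 2) := by
    rw [← Finset.sum_range_reflect, Finset.sum_range_succ']
    have h4 : tail p (n + 1 + (n + 1 - 1 - 0)) (((n + 1 - 1 - 0 : ℕ) : ℤ) - (n + 1 : ℕ) + 1) =
        1 / 2 := by
      have h5 := one_sub_tail hp (2 * n + 1) 0
      have h6 := tail_parity p (m := 2 * n + 1) (d := -1) (by push_cast; omega)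
      norm_num at h5 h6
      rw [show n + 1 + (n + 1 - 1 - 0) = 2 * n + 1 by omega,
        show (((n + 1 - 1 - 0 : ℕ) : ℤ) - (n + 1 : ℕ) + 1) = 0 by simp]
      linarith
    have h5 : ∀ s ∈ Finset.range n, tail p (n + 1 + (n + 1 - 1 - (s + 1)))
        (((n + 1 - 1 - (s + 1) : ℕ) : ℤ) - (n + 1 : ℕ) + 1) =
        1 - tail p (2 * n - s) ((s : ℤ) + 2) := by
      intro s hs
      have hs' := Finset.mem_range.1 hs
      have h6 := one_sub_tail hp (2 * n - s) (s + 1)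
      rw [show n + 1 + (n + 1 - 1 - (s + 1)) = 2 * n - s by omega,
        show (((n + 1 - 1 - (s + 1) : ℕ) : ℤ) - (n + 1 : ℕ) + 1) = -((s : ℤ) + 1) by omega]
      rw [show (s : ℤ) + 1 + 1 = s + 2 by ring] at h6
      linarith
    rw [h4, Finset.sum_congr rfl h5, Finset.sum_sub_distrib]
    simp
    ring
  have h4 : HasSum (fun s : ℕ => if s < n then tail p (2 * n - s) ((s : ℤ) + 2) else 0)
      (∑ s ∈ Finset.range n, tail p (2 * n - s) ((s : ℤ) + 2)) := by
    have h5 := hasSum_sum_of_ne_finset_zero (L := .unconditional ℕ) (s := Finset.range n)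
      (f := fun s : ℕ => if s < n then tail p (2 * n - s) ((s : ℤ) + 2) else 0)
      (fun s hs => if_neg fun h => hs (Finset.mem_range.2 h))
    rwa [Finset.sum_congr rfl fun s hs => if_pos (Finset.mem_range.1 hs)] at h5
  rw [meanShift, ← h2.sum_add_tsum_nat_add (n + 1), h1, h3, hS.tsum_sub h4.summable, h4.tsum_eq]
  push_cast
  ring

theorem tail_mono_two_mul {p : ℤ → ℝ} (hp : Repelling p) (s : ℕ) {d : ℤ} (hd : 1 ≤ d) :
    Monotone fun k : ℕ => tail p (s + 2 * k) d :=
  monotone_nat_of_le_succ fun k => tail_le_add_two hp (s + 2 * k) hd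

theorem shiftTerm_nonneg {p : ℤ → ℝ} (hp : Repelling p) (n s : ℕ) :
    0 ≤ tail p (2 * n + 2 + s) ((s : ℤ) + 2) -
      if s < n then tail p (2 * n - s) ((s : ℤ) + 2) else 0 := by
  split_ifs with h
  · have h1 := tail_mono_two_mul hp s (d := s + 2) (by omega)
      (show n - s ≤ n + 1 by omega)
    simp only at h1
    rw [show s + 2 * (n - s) = 2 * n - s by omega,
      show s + 2 * (n + 1) = 2 * n + 2 + s by ring] at h1
    linarith
  · rw [sub_zero]
    exact tail_nonneg _ _ _

theorem neg_half_le_meanShift {p : ℤ → ℝ} (hp : Repelling p) (n : ℕ) :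
    -1 / 2 ≤ meanShift p n := by
  cases n with
  | zero =>
    rw [meanShift]
    have : 0 ≤ ∑' t : ℕ, tail p (0 + t) (t - (0 : ℕ) + 1) := tsum_nonneg fun _ => tail_nonneg _ _ _
    push_cast at this ⊢
    linarith
  | succ n =>
    rw [meanShift_succ hp]
    have := tsum_nonneg (L := .unconditional ℕ) fun s => shiftTerm_nonneg hp n s
    linarith

theorem tendsto_meanShift {p : ℤ → ℝ} (hp : Repelling p) :
    Tendsto (meanShift p) atTop (𝓝 (-1 / 2)) := by
  rw [← tendsto_add_atTop_iff_nat 1]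
  simp only [meanShift_succ hp]
  obtain ⟨l, hl, C, hC, h⟩ := exists_tail_le hp
  have h1 : Tendsto (fun n : ℕ => ∑' s : ℕ, (tail p (2 * n + 2 + s) (s + 2) -
      if s < n then tail p (2 * n - s) (s + 2) else 0)) atTop (𝓝 (∑' s : ℕ, (0 : ℝ))) := by
    refine tendsto_tsum_of_dominated_convergence (bound := fun s : ℕ => C * l⁻¹ ^ s)
      ((summable_geometric_of_lt_one (r := l⁻¹) (by positivity)
      (inv_lt_one_of_one_lt₀ hl)).mul_left C) (fun s => ?_) (Eventually.of_forall fun n s => ?_)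
    · have hmono := tail_mono_two_mul hp s (d := s + 2) (by omega)
      have hlim := tendsto_atTop_ciSup hmono ⟨1, by rintro _ ⟨k, rfl⟩; exact tail_le_one _ _ _⟩
      have h2 := hlim.comp (tendsto_add_atTop_nat 1)
      have h3 := hlim.comp (tendsto_sub_atTop_nat s)
      have h4 := h2.sub h3
      rw [sub_self] at h4
      refine h4.congr' ?_
      filter_upwards [eventually_gt_atTop s] with n hn
      rw [if_pos hn]
      simp only [Function.comp]
      rw [show s + 2 * (n - s) = 2 * n - s by omega,
        show s + 2 * (n + 1) = 2 * n + 2 + s by ring]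
    · rw [Real.norm_of_nonneg (shiftTerm_nonneg hp n s)]
      have h2 : 0 ≤ if s < n then tail p (2 * n - s) ((s : ℤ) + 2) else 0 := by
        split_ifs
        · exact tail_nonneg _ _ _
        · exact le_rfl
      have h3 := h (2 * n + 2 + s) (s + 2)
      have h4 : l⁻¹ ^ (s + 2) ≤ l⁻¹ ^ s :=
        pow_le_pow_of_le_one (by positivity) (inv_le_one_of_one_le₀ hl.le) (by omega)
      have h5 : C * l⁻¹ ^ (s + 2) ≤ C * l⁻¹ ^ s := by gcongr
      push_cast at h3
      linarith
  rw [tsum_zero] at h1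
  simpa using h1.const_add (-1 / 2)

theorem exists_siteLaw {p : ℤ → ℝ} (hp : Repelling p) :
    ∃ θ > (0 : ℝ), ∃ C > (0 : ℝ), ∃ e c₀ : ℕ → ℝ, (∀ n, -1 / 2 ≤ e n) ∧
      Tendsto e atTop (𝓝 (-1 / 2)) ∧ (∀ n, 0 < c₀ n) ∧
      ∀ c, SiteCount p c → SiteLaw siteMeasure θ C e c₀ fun v => other (c v) := by
  obtain ⟨l, hl, C, hC, h⟩ := exists_tail_le hp
  have hb : 1 < √l := by
    rw [← Real.sqrt_one]
    exact Real.sqrt_lt_sqrt zero_le_one hl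
  have hbl : √l * √l = l := Real.mul_self_sqrt (by linarith)
  have hb1 : 0 < 1 - (√l)⁻¹ := by
    have := inv_lt_one_of_one_lt₀ hb
    linarith
  refine ⟨Real.log √l, Real.log_pos hb, (2 * C + 1) * (1 - (√l)⁻¹)⁻¹, by positivity, meanShift p,
    fun n => if n = 0 then 1 else tail p n n, neg_half_le_meanShift hp, tendsto_meanShift hp,
    fun n => ?_, fun c hc => ?_⟩
  · dsimp only
    split_ifs
    · exact one_pos
    · exact tail_self_pos hp n
  have hmeas : ∀ n, Measurable fun v => other (c v) n := fun n =>
    measurable_pi_iff.1 hc.measurable_other n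
  have habs : ∀ n, Measurable fun v => ((other (c v) n : ℤ) - n).natAbs := fun n =>
    (measurable_of_countable fun k : ℕ => ((k : ℤ) - n).natAbs).comp (hmeas n)
  have hcast : ∀ (v : ℕ → ℝ) (n : ℕ), Real.exp (Real.log √l * |(other (c v) n : ℝ) - n|) =
      √l ^ ((other (c v) n : ℤ) - n).natAbs := by
    intro v n
    rw [← Real.rpow_natCast, Real.rpow_def_of_pos (by positivity), Nat.cast_natAbs]
    push_cast
    rfl
  have hmom : ∀ n : ℕ, _ := fun n => exp_moment_of_tail (P := siteMeasure) (habs n) (D := 2 * C + 1) hb (fun k => by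
    rw [hbl]
    cases k with
    | zero => simp; linarith
    | succ s =>
      have h1 : siteMeasure.real {v | n + s < other (c v) n} ≤ C * l⁻¹ ^ (s + 1) := by
        rw [hc.measureReal_lt_other hp]
        have := h (n + (n + s)) (s + 1)
        convert this using 2
        push_cast; ring
      have h2 : siteMeasure.real {v | other (c v) n + s < n} ≤ C * l⁻¹ ^ (s + 1) := by
        by_cases hs : s < n
        · have h3 := hc.measureReal_lt_other hp n (n - 1 - s)
          have h4 := probReal_compl_eq_one_sub (μ := siteMeasure)
            (measurableSet_lt (measurable_const (a := n - 1 - s)) (hmeas n))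
          have h5 : {v | n - 1 - s < other (c v) n}ᶜ = {v | other (c v) n + s < n} := by
            ext v
            simp only [Set.mem_compl_iff, Set.mem_ofPred_eq]
            omega
          rw [h5, h3, show ((n - 1 - s : ℕ) : ℤ) - n + 1 = -(s : ℤ) by omega, one_sub_tail hp] at h4
          rw [h4]
          exact_mod_cast h _ (s + 1)
        · have : {v | other (c v) n + s < n} = ∅ := by
            ext v
            simp only [Set.mem_ofPred_eq, Set.mem_empty_iff_false, iff_false]
            omega
          rw [this, measureReal_empty]
          positivity
      have h3 : {v | s + 1 ≤ ((other (c v) n : ℤ) - n).natAbs} =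
          {v | n + s < other (c v) n} ∪ {v | other (c v) n + s < n} := by
        ext v
        simp only [Set.mem_union, Set.mem_ofPred_eq]
        omega
      rw [h3]
      refine (measureReal_union_le _ _).trans ?_
      have : 0 < l⁻¹ ^ (s + 1) := by positivity
      nlinarith)
  have hint : ∀ n, Integrable (fun v => Real.exp (Real.log √l * |(other (c v) n : ℝ) - n|))
      siteMeasure := fun n => by
    simp only [hcast]
    exact (hmom n).1
  have hL : SiteLaw siteMeasure (Real.log √l) ((2 * C + 1) * (1 - (√l)⁻¹)⁻¹)
      (fun n => ∫ v, ((other (c v) n : ℝ) - n) ∂siteMeasure) 0 fun v => other (c v) := by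
    refine ⟨hc.measurable_other, fun v => other_zero _, hint, fun n => ?_, fun n => rfl,
      fun n => measureReal_nonneg⟩
    simp only [hcast]
    exact (hmom n).2
  refine ⟨hL.meas, hL.zero, hL.exp_int, hL.exp_le, fun n => ?_, fun n => ?_⟩
  · rw [integral_sub (hL.integrable (Real.log_pos hb) n) (integrable_const _),
      integral_nat_eq_tsum (hmeas n)]
    simp only [hc.measureReal_lt_other hp, integral_const, probReal_univ, smul_eq_mul, one_mul]
    rfl
  · split_ifs with hn
    · subst hn
      simp [other_zero]
    · have h3 := hc.measureReal_lt_other hp n 0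
      have h4 := probReal_compl_eq_one_sub (μ := siteMeasure)
        (measurableSet_lt (measurable_const (a := 0)) (hmeas n))
      have h5 : {v | 0 < other (c v) n}ᶜ = {v | other (c v) n = 0} := by
        ext v
        simp only [Set.mem_compl_iff, Set.mem_ofPred_eq]
        omega
      rw [h5, h3, show ((0 : ℕ) : ℤ) - n + 1 = -((n : ℤ) - 1) by push_cast; ring,
        one_sub_tail hp] at h4
      rw [h4]
      simp

/-- The deterministic input `1` added to a chain at its first `m` steps. -/
def bump (m i : ℕ) : ℕ := if i < m then 1 else 0

/-- The chain `Y (i + 1) = q i (Y i + bump m i)`. -/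
def chain (q : ℕ → ℕ → ℕ) (n₀ m : ℕ) : ℕ → ℕ
  | 0 => n₀
  | i + 1 => q i (chain q n₀ m i + bump m i)

/-- The fluctuation of the chain around its compensator. -/
def fluct (e : ℕ → ℝ) (q : ℕ → ℕ → ℕ) (n₀ m : ℕ) : ℕ → ℝ
  | 0 => 0
  | i + 1 => fluct e q n₀ m i + ((q i (chain q n₀ m i + bump m i) : ℝ) -
      ((chain q n₀ m i + bump m i : ℕ) : ℝ) - e (chain q n₀ m i + bump m i))

theorem chain_congr {q q' : ℕ → ℕ → ℕ} (n₀ m i : ℕ) (h : ∀ j < i, q j = q' j) :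
    chain q n₀ m i = chain q' n₀ m i := by
  induction i with
  | zero => rfl
  | succ i ih => rw [chain, chain, ih fun j hj => h j (by omega), h i (by omega)]

theorem fluct_congr (e : ℕ → ℝ) {q q' : ℕ → ℕ → ℕ} (n₀ m i : ℕ) (h : ∀ j < i, q j = q' j) :
    fluct e q n₀ m i = fluct e q' n₀ m i := by
  induction i with
  | zero => rfl
  | succ i ih =>
    rw [fluct, fluct, ih fun j hj => h j (by omega), h i (by omega),
      chain_congr n₀ m i fun j hj => h j (by omega)]

theorem measurable_eval_nat {α : Type*} [MeasurableSpace α] {y : α → ℕ} (hy : Measurable y)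
    {q : α → ℕ → ℕ} (hq : Measurable q) : Measurable fun a => q a (y a) := by
  have h : Measurable fun z : ℕ × (ℕ → ℕ) => z.2 z.1 :=
    measurable_from_prod_countable_right fun n => measurable_pi_apply n
  exact h.comp (hy.prodMk hq)

theorem measurable_chain (n₀ m i : ℕ) :
    Measurable fun q : ℕ → ℕ → ℕ => chain q n₀ m i := by
  induction i with
  | zero => exact measurable_const
  | succ i ih => exact measurable_eval_nat (ih.add measurable_const) (measurable_pi_apply i)

theorem measurable_fluct (e : ℕ → ℝ) (n₀ m i : ℕ) :
    Measurable fun q : ℕ → ℕ → ℕ => fluct e q n₀ m i := by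
  induction i with
  | zero => exact measurable_const
  | succ i ih =>
    have hc := measurable_chain n₀ m i
    have h1 : Measurable fun q : ℕ → ℕ → ℕ => q i (chain q n₀ m i + bump m i) :=
      measurable_chain n₀ m (i + 1)
    refine ih.add ((((measurable_of_countable _).comp h1).sub ?_).sub ?_)
    · exact (measurable_of_countable fun k : ℕ => ((k + bump m i : ℕ) : ℝ)).comp hc
    · exact (measurable_of_countable fun k : ℕ => e (k + bump m i)).comp hc

theorem lintegral_step {Ω γ : Type*} [MeasurableSpace Ω] [MeasurableSpace γ] {P : Measure Ω}
    [IsProbabilityMeasure P] {Q : ℕ → Ω → ℕ → ℕ} (hQ : iIndepFun Q P)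
    (hm : ∀ i, Measurable (Q i)) (i : ℕ) {F : (ℕ → ℕ → ℕ) → γ} (hF : Measurable F)
    (hdep : ∀ x y, (∀ j < i, x j = y j) → F x = F y) {H : γ × (ℕ → ℕ) → ℝ≥0∞}
    (hH : Measurable H) {B : γ → ℝ≥0∞}
    (hB : ∀ u, ∫⁻ ω, H (u, Q i ω) ∂P ≤ B u) :
    ∫⁻ ω, H (F fun j => Q j ω, Q i ω) ∂P ≤ ∫⁻ ω, B (F fun j => Q j ω) ∂P := by
  have hind := indepFun_initial_segment hQ hm i hF hdep
  have hFm : Measurable fun ω => F fun j => Q j ω := hF.comp (measurable_pi_lambda _ hm)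
  have hmap := hind.map_prod_eq_prod_map_map hFm.aemeasurable (hm i).aemeasurable
  have := Measure.isProbabilityMeasure_map (μ := P) (hm i).aemeasurable
  rw [← lintegral_map hH (hFm.prodMk (hm i)), hmap, lintegral_prod _ hH.aemeasurable,
    lintegral_map hH.lintegral_prod_right' hFm]
  refine lintegral_mono fun ω => ?_
  rw [lintegral_map (f := fun y => H (F fun j => Q j ω, y)) (hH.comp measurable_prodMk_left) (hm i)]
  exact hB _

/-- An independent sequence of maps, all satisfying the same quantitative bounds. -/
structure ChainLaw {Ω : Type*} [MeasurableSpace Ω] (P : Measure Ω) (θ C : ℝ) (e c₀ : ℕ → ℝ)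
    (Q : ℕ → Ω → ℕ → ℕ) : Prop where
  indep : iIndepFun Q P
  site : ∀ i, SiteLaw P θ C e c₀ (Q i)

theorem exp_le_quadratic (x : ℝ) : Real.exp x ≤ 1 + x + x ^ 2 * Real.exp |x| := by
  have h := Complex.norm_exp_sub_sum_le_norm_mul_exp (x : ℂ) 2
  simp only [Finset.sum_range_succ, Finset.sum_range_zero, pow_zero, pow_one, Nat.factorial,
    Nat.cast_one, div_one, zero_add, mul_one] at h
  rw [← Complex.ofReal_exp, ← Complex.ofReal_one, ← Complex.ofReal_add, ← Complex.ofReal_sub,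
    Complex.norm_real, Complex.norm_real, Real.norm_eq_abs, Real.norm_eq_abs, sq_abs] at h
  have := (abs_le.1 h).2
  linarith

section SiteLawBounds

variable {Ω : Type*} [MeasurableSpace Ω] {P : Measure Ω} [IsProbabilityMeasure P]
  {θ C : ℝ} {e c₀ : ℕ → ℝ} {Q : Ω → ℕ → ℕ}

theorem SiteLaw.abs_mean_le (hθ : 0 < θ) (hQ : SiteLaw P θ C e c₀ Q) (n : ℕ) :
    |e n| ≤ C / θ := by
  have h1 := (hQ.integrable hθ n).sub (integrable_const (n : ℝ))
  rw [← hQ.mean n]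
  refine (abs_integral_le_integral_abs).trans ?_
  rw [le_div_iff₀ hθ, ← integral_mul_const]
  refine (integral_mono (h1.abs.mul_const θ) (hQ.exp_int n) fun ω => ?_).trans (hQ.exp_le n)
  have h2 := Real.add_one_le_exp (θ * |(Q ω n : ℝ) - n|)
  show |(Q ω n : ℝ) - n| * θ ≤ Real.exp (θ * |(Q ω n : ℝ) - n|)
  linarith

/-- The constant of the sub-Gaussian bound for the centred displacement of a site. -/
def varBound (θ C : ℝ) : ℝ := 8 / θ ^ 2 * (C * Real.exp C)

theorem SiteLaw.lintegral_exp_le (hθ : 0 < θ) (hQ : SiteLaw P θ C e c₀ Q) (n : ℕ) {s : ℝ}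
    (hs : |s| ≤ θ / 2) :
    ∫⁻ ω, ENNReal.ofReal (Real.exp (s * ((Q ω n : ℝ) - n - e n))) ∂P ≤
      ENNReal.ofReal (Real.exp (varBound θ C * s ^ 2)) := by
  have hi₀ : Integrable (fun ω => (Q ω n : ℝ) - n) P :=
    (hQ.integrable hθ n).sub (integrable_const (n : ℝ))
  have hi : Integrable (fun ω => (Q ω n : ℝ) - n - e n) P := hi₀.sub (integrable_const (e n))
  have hi₁ : Integrable (fun ω => 1 + s * ((Q ω n : ℝ) - n - e n)) P :=
    (integrable_const (1 : ℝ)).add (hi.const_mul s)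
  have he := hQ.abs_mean_le hθ n
  have hpt : ∀ ω, Real.exp (s * ((Q ω n : ℝ) - n - e n)) ≤ 1 + s * ((Q ω n : ℝ) - n - e n) +
      s ^ 2 * (8 / θ ^ 2 * (Real.exp C * Real.exp (θ * |(Q ω n : ℝ) - n|))) := by
    intro ω
    set z := (Q ω n : ℝ) - n - e n with hz
    refine (exp_le_quadratic _).trans ?_
    have h1 : |z| ≤ |(Q ω n : ℝ) - n| + C / θ := (abs_sub _ _).trans (by linarith)
    have h2 : (θ * |z| / 2) ^ 2 / 2 ≤ Real.exp (θ * |z| / 2) := by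
      have := Real.quadratic_le_exp_of_nonneg (x := θ * |z| / 2) (by positivity)
      have h3 : 0 ≤ θ * |z| / 2 := by positivity
      linarith
    have h3 : Real.exp |s * z| ≤ Real.exp (θ * |z| / 2) := by
      rw [abs_mul]
      refine Real.exp_le_exp.2 ?_
      nlinarith [abs_nonneg z]
    have h4 : Real.exp (θ * |z| / 2) * Real.exp (θ * |z| / 2) ≤
        Real.exp C * Real.exp (θ * |(Q ω n : ℝ) - n|) := by
      rw [← Real.exp_add, ← Real.exp_add]
      refine Real.exp_le_exp.2 ?_
      have : θ * |z| ≤ θ * (|(Q ω n : ℝ) - n| + C / θ) := by gcongr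
      rw [mul_add, mul_div_cancel₀ _ hθ.ne'] at this
      linarith
    have h5 : z ^ 2 = 8 / θ ^ 2 * ((θ * |z| / 2) ^ 2 / 2) := by
      rw [← sq_abs z]; field_simp; ring
    have h6 : (s * z) ^ 2 * Real.exp |s * z| ≤
        s ^ 2 * (8 / θ ^ 2 * (Real.exp C * Real.exp (θ * |(Q ω n : ℝ) - n|))) := by
      rw [mul_pow, mul_assoc]
      refine mul_le_mul_of_nonneg_left ?_ (sq_nonneg s)
      calc z ^ 2 * Real.exp |s * z|
          ≤ (8 / θ ^ 2 * Real.exp (θ * |z| / 2)) * Real.exp (θ * |z| / 2) := by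
            rw [h5]; gcongr
        _ ≤ _ := by rw [mul_assoc]; gcongr
    linarith
  have hint2 := (((hQ.exp_int n).const_mul (Real.exp C)).const_mul (8 / θ ^ 2)).const_mul (s ^ 2)
  have hint := hi₁.add hint2
  have hI : ∫ ω, (1 + s * ((Q ω n : ℝ) - n - e n) +
      s ^ 2 * (8 / θ ^ 2 * (Real.exp C * Real.exp (θ * |(Q ω n : ℝ) - n|)))) ∂P ≤
      Real.exp (varBound θ C * s ^ 2) := by
    have h1 : ∫ ω, ((Q ω n : ℝ) - n - e n) ∂P = 0 := by
      rw [integral_sub hi₀ (integrable_const _), hQ.mean n]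
      simp
    rw [integral_add hi₁ hint2,
      integral_add (integrable_const (1 : ℝ)) (hi.const_mul s)]
    simp only [integral_const_mul]
    rw [h1]
    have h2 := hQ.exp_le n
    have h3 : s ^ 2 * (8 / θ ^ 2 * (Real.exp C * ∫ ω, Real.exp (θ * |(Q ω n : ℝ) - n|) ∂P)) ≤
        s ^ 2 * (8 / θ ^ 2 * (Real.exp C * C)) := by gcongr
    have h4 := Real.add_one_le_exp (varBound θ C * s ^ 2)
    simp only [varBound, integral_const, probReal_univ, smul_eq_mul, one_mul, mul_zero,
      add_zero] at h4 ⊢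
    linarith
  calc ∫⁻ ω, ENNReal.ofReal (Real.exp (s * ((Q ω n : ℝ) - n - e n))) ∂P
      ≤ ∫⁻ ω, ENNReal.ofReal (1 + s * ((Q ω n : ℝ) - n - e n) +
      s ^ 2 * (8 / θ ^ 2 * (Real.exp C * Real.exp (θ * |(Q ω n : ℝ) - n|)))) ∂P :=
        lintegral_mono fun ω => ENNReal.ofReal_le_ofReal (hpt ω)
    _ = ENNReal.ofReal (∫ ω, (1 + s * ((Q ω n : ℝ) - n - e n) +
      s ^ 2 * (8 / θ ^ 2 * (Real.exp C * Real.exp (θ * |(Q ω n : ℝ) - n|)))) ∂P) :=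
        (ofReal_integral_eq_lintegral_ofReal hint
          (ae_of_all _ fun ω => (Real.exp_pos _).le.trans (hpt ω))).symm
    _ ≤ _ := ENNReal.ofReal_le_ofReal hI

theorem SiteLaw.lintegral_eq (hθ : 0 < θ) (hQ : SiteLaw P θ C e c₀ Q) (n : ℕ) :
    ∫⁻ ω, ENNReal.ofReal (Q ω n) ∂P = ENNReal.ofReal (n + e n) := by
  have h := hQ.integrable hθ n
  rw [← ofReal_integral_eq_lintegral_ofReal h (ae_of_all _ fun ω => Nat.cast_nonneg _)]
  have h2 := hQ.mean n
  rw [integral_sub h (integrable_const _)] at h2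
  simp only [integral_const, probReal_univ, smul_eq_mul, one_mul] at h2
  congr 1
  linarith

end SiteLawBounds

section ChainBounds

variable {Ω : Type*} [MeasurableSpace Ω] {P : Measure Ω} [IsProbabilityMeasure P]
  {θ C : ℝ} {e c₀ : ℕ → ℝ} {Q : ℕ → Ω → ℕ → ℕ}

theorem ChainLaw.lintegral_exp_fluct (hθ : 0 < θ) (hQ : ChainLaw P θ C e c₀ Q) (n₀ m : ℕ) {s : ℝ}
    (hs : |s| ≤ θ / 2) (i : ℕ) :
    ∫⁻ ω, ENNReal.ofReal (Real.exp (s * fluct e (fun j => Q j ω) n₀ m i)) ∂P ≤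
      ENNReal.ofReal (Real.exp (varBound θ C * s ^ 2 * i)) := by
  induction i with
  | zero => simp [fluct]
  | succ i ih =>
    let H : (ℕ × ℝ) × (ℕ → ℕ) → ℝ≥0∞ := fun z => ENNReal.ofReal (Real.exp (s * (z.1.2 +
      ((z.2 (z.1.1 + bump m i) : ℝ) - ((z.1.1 + bump m i : ℕ) : ℝ) - e (z.1.1 + bump m i)))))
    let B : ℕ × ℝ → ℝ≥0∞ := fun z =>
      ENNReal.ofReal (Real.exp (varBound θ C * s ^ 2)) * ENNReal.ofReal (Real.exp (s * z.2))
    have hH : Measurable H := by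
      have h1 : Measurable fun z : (ℕ × ℝ) × (ℕ → ℕ) => z.2 (z.1.1 + bump m i) :=
        measurable_eval_nat (by fun_prop) measurable_snd
      have h2 : Measurable fun z : (ℕ × ℝ) × (ℕ → ℕ) => (z.2 (z.1.1 + bump m i) : ℝ) :=
        (measurable_of_countable _).comp h1
      have h3 : Measurable fun z : (ℕ × ℝ) × (ℕ → ℕ) => ((z.1.1 + bump m i : ℕ) : ℝ) :=
        (measurable_of_countable fun k : ℕ => ((k + bump m i : ℕ) : ℝ)).comp
          (measurable_fst.comp measurable_fst)
      have h4 : Measurable fun z : (ℕ × ℝ) × (ℕ → ℕ) => e (z.1.1 + bump m i) :=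
        (measurable_of_countable fun k : ℕ => e (k + bump m i)).comp
          (measurable_fst.comp measurable_fst)
      exact ((((measurable_snd.comp measurable_fst).add ((h2.sub h3).sub h4)).const_mul s).exp).ennreal_ofReal
    have h := lintegral_step hQ.indep (fun j => (hQ.site j).meas) i
      (F := fun q => (chain q n₀ m i, fluct e q n₀ m i))
      ((measurable_chain n₀ m i).prodMk (measurable_fluct e n₀ m i))
      (fun x y hxy => by rw [chain_congr n₀ m i hxy, fluct_congr e n₀ m i hxy]) (B := B) hH (by
        rintro ⟨y, x⟩
        have h1 : ∀ ω, H ((y, x), Q i ω) = ENNReal.ofReal (Real.exp (s * x)) *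
            ENNReal.ofReal (Real.exp (s * ((Q i ω (y + bump m i) : ℝ) -
              ((y + bump m i : ℕ) : ℝ) - e (y + bump m i)))) := by
          intro ω
          rw [← ENNReal.ofReal_mul (Real.exp_pos _).le, ← Real.exp_add, ← mul_add]
        simp only [h1]
        rw [lintegral_const_mul' _ _ ENNReal.ofReal_ne_top, mul_comm]
        exact mul_le_mul_left ((hQ.site i).lintegral_exp_le hθ _ hs) _)
    calc _ ≤ _ := h
      _ ≤ ENNReal.ofReal (Real.exp (varBound θ C * s ^ 2)) *
          ENNReal.ofReal (Real.exp (varBound θ C * s ^ 2 * i)) := by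
          rw [lintegral_const_mul' _ _ ENNReal.ofReal_ne_top]
          exact mul_le_mul_right ih _
      _ = _ := by
          rw [← ENNReal.ofReal_mul (Real.exp_pos _).le, ← Real.exp_add]
          congr 2
          push_cast
          ring

theorem ChainLaw.prob_lt_fluct (hθ : 0 < θ) (hQ : ChainLaw P θ C e c₀ Q) (n₀ m : ℕ) {s : ℝ}
    (hs0 : 0 ≤ s) (hs : s ≤ θ / 2) (i : ℕ) (d : ℝ) :
    P {ω | d < |fluct e (fun j => Q j ω) n₀ m i|} ≤
      ENNReal.ofReal (2 * Real.exp (varBound θ C * s ^ 2 * i - s * d)) := by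
  have key : ∀ t : ℝ, |t| ≤ θ / 2 → P {ω | s * d ≤ t * fluct e (fun j => Q j ω) n₀ m i} ≤
      ENNReal.ofReal (Real.exp (varBound θ C * t ^ 2 * i - s * d)) := by
    intro t ht
    have h1 := hQ.lintegral_exp_fluct hθ n₀ m ht i
    have hm : Measurable fun ω => fluct e (fun j => Q j ω) n₀ m i :=
      (measurable_fluct e n₀ m i).comp (measurable_pi_lambda _ fun j => (hQ.site j).meas)
    have h2 := meas_ge_le_lintegral_div (μ := P)
      (f := fun ω => ENNReal.ofReal (Real.exp (t * fluct e (fun j => Q j ω) n₀ m i)))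
      (ε := ENNReal.ofReal (Real.exp (s * d))) (hm.const_mul t).exp.ennreal_ofReal.aemeasurable
      (by simp [Real.exp_pos]) ENNReal.ofReal_ne_top
    rw [Real.exp_sub, ENNReal.ofReal_div_of_pos (Real.exp_pos _)]
    refine le_trans (measure_mono fun ω hω => ?_) (h2.trans (ENNReal.div_le_div_right h1 _))
    exact ENNReal.ofReal_le_ofReal (Real.exp_le_exp.2 hω)
  have h1 := key s (by rwa [abs_of_nonneg hs0])
  have h2 := key (-s) (by rwa [abs_neg, abs_of_nonneg hs0])
  rw [neg_sq] at h2
  rw [two_mul, ENNReal.ofReal_add (Real.exp_pos _).le (Real.exp_pos _).le]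
  refine le_trans (measure_mono fun ω hω => ?_)
    ((measure_union_le _ _).trans (add_le_add h1 h2))
  have hω' : d < |fluct e (fun j => Q j ω) n₀ m i| := hω
  rcases lt_abs.1 hω' with h | h
  · exact Or.inl (mul_le_mul_of_nonneg_left h.le hs0)
  · refine Or.inr ?_
    show s * d ≤ -s * _
    rw [neg_mul, ← mul_neg]
    exact mul_le_mul_of_nonneg_left h.le hs0

end ChainBounds

theorem chain_eq_zero_of_le {q : ℕ → ℕ → ℕ} (hq : ∀ i, q i 0 = 0) {n₀ m k : ℕ} (hk : m ≤ k)
    (h : chain q n₀ m k = 0) {i : ℕ} (hi : k ≤ i) : chain q n₀ m i = 0 := by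
  induction i, hi using Nat.le_induction with
  | base => exact h
  | succ i hi ih =>
    rw [chain, ih, bump, if_neg (by omega)]
    exact hq i

section ChainBounds

variable {Ω : Type*} [MeasurableSpace Ω] {P : Measure Ω} [IsProbabilityMeasure P]
  {θ C : ℝ} {e c₀ : ℕ → ℝ} {Q : ℕ → Ω → ℕ → ℕ}

theorem ChainLaw.measurable_chain (hQ : ChainLaw P θ C e c₀ Q) (n₀ m i : ℕ) :
    Measurable fun ω => chain (fun j => Q j ω) n₀ m i :=
  (SelfRepelling.measurable_chain n₀ m i).comp (measurable_pi_lambda _ fun j => (hQ.site j).meas)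

theorem ChainLaw.lintegral_chain (hθ : 0 < θ) (hQ : ChainLaw P θ C e c₀ Q) {D : ℝ} (hD : 0 ≤ D)
    (he : ∀ n, e n ≤ D) (n₀ m i : ℕ) :
    ∫⁻ ω, ENNReal.ofReal (chain (fun j => Q j ω) n₀ m i) ∂P ≤
      ENNReal.ofReal (n₀ + i * (1 + D)) := by
  induction i with
  | zero => simp [chain]
  | succ i ih =>
    have h := lintegral_step hQ.indep (fun j => (hQ.site j).meas) i
      (F := fun q => chain q n₀ m i) (SelfRepelling.measurable_chain n₀ m i)
      (fun x y hxy => chain_congr n₀ m i hxy)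
      (H := fun z => ENNReal.ofReal (z.2 (z.1 + bump m i) : ℝ))
      (B := fun y => ENNReal.ofReal y + ENNReal.ofReal (1 + D))
      (((measurable_of_countable fun k : ℕ => ENNReal.ofReal (k : ℝ))).comp
        (measurable_eval_nat (y := fun z : ℕ × (ℕ → ℕ) => z.1 + bump m i)
          (measurable_fst.add measurable_const) measurable_snd)) (by
        intro y
        dsimp only
        rw [(hQ.site i).lintegral_eq hθ, ← ENNReal.ofReal_add (by positivity) (by positivity)]
        refine ENNReal.ofReal_le_ofReal ?_
        have h1 := he (y + bump m i)
        have h2 : (bump m i : ℝ) ≤ 1 := by unfold bump; split_ifs <;> simp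
        push_cast
        linarith)
    refine h.trans ?_
    rw [lintegral_add_right _ measurable_const]
    simp only [lintegral_const, measure_univ, mul_one]
    calc _ ≤ ENNReal.ofReal (n₀ + i * (1 + D)) + ENNReal.ofReal (1 + D) := by gcongr
      _ = _ := by
        rw [← ENNReal.ofReal_add (by positivity) (by positivity)]
        push_cast
        ring_nf

theorem ChainLaw.prob_alive_mul_le (hθ : 0 < θ) (hQ : ChainLaw P θ C e c₀ Q) {B D : ℝ}
    (hB : 0 ≤ B) (hBe : ∀ n, 1 ≤ n → e n + 1 / 4 ≤ B * c₀ n) (hD : 0 ≤ D) (he : ∀ n, e n ≤ D)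
    (n₀ m k : ℕ) :
    ENNReal.ofReal (k / 4) * P {ω | 1 ≤ chain (fun j => Q j ω) n₀ m (m + k)} ≤
      ENNReal.ofReal (n₀ + m * (1 + D) + B) := by
  let g : ℕ → ℝ≥0∞ := fun y => ENNReal.ofReal y + if 1 ≤ y then ENNReal.ofReal B else 0
  have hq0 : ∀ ω i, (fun j => Q j ω) i 0 = 0 := fun ω i => (hQ.site i).zero ω
  have hstep : ∀ i, m ≤ i → ∫⁻ ω, g (chain (fun j => Q j ω) n₀ m (i + 1)) ∂P +
      ENNReal.ofReal (1 / 4) * P {ω | 1 ≤ chain (fun j => Q j ω) n₀ m i} ≤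
      ∫⁻ ω, g (chain (fun j => Q j ω) n₀ m i) ∂P := by
    intro i hi
    have h := lintegral_step hQ.indep (fun j => (hQ.site j).meas) i
      (F := fun q => chain q n₀ m i) (SelfRepelling.measurable_chain n₀ m i)
      (fun x y hxy => chain_congr n₀ m i hxy)
      (H := fun z => g (z.2 (z.1 + 0)) + if 1 ≤ z.1 then ENNReal.ofReal (1 / 4) else 0)
      (B := g) ((((measurable_of_countable g).comp (measurable_eval_nat (y := fun z : ℕ × (ℕ → ℕ) => z.1 + 0)
          (by fun_prop) measurable_snd))).add
          ((measurable_of_countable fun y : ℕ => if 1 ≤ y then ENNReal.ofReal (1 / 4) else 0).comp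
            measurable_fst)) (by
        intro y
        change ∫⁻ ω, (g (Q i ω y) + if 1 ≤ y then ENNReal.ofReal (1 / 4) else 0) ∂P ≤ g y
        rcases Nat.eq_zero_or_pos y with rfl | hy
        · simp [g, (hQ.site i).zero]
        · have hmy : Measurable fun ω => Q i ω y := measurable_pi_iff.1 (hQ.site i).meas y
          have hms : MeasurableSet {ω | 1 ≤ Q i ω y} := measurableSet_le measurable_const hmy
          have h1 : ∫⁻ ω, (if 1 ≤ Q i ω y then ENNReal.ofReal B else 0) ∂P =
              ENNReal.ofReal B * P {ω | 1 ≤ Q i ω y} := by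
            rw [← lintegral_indicator_const hms]
            exact lintegral_congr fun ω => by simp [Set.indicator_apply]
          have h2 : P {ω | 1 ≤ Q i ω y} ≤ ENNReal.ofReal (1 - c₀ y) := by
            have h3 := probReal_compl_eq_one_sub (μ := P) (hmy (measurableSet_singleton 0))
            have h4 : ((fun ω => Q i ω y) ⁻¹' {0})ᶜ = {ω | 1 ≤ Q i ω y} := by
              ext ω
              simp only [Set.mem_compl_iff, Set.mem_preimage, Set.mem_singleton_iff,
                Set.mem_ofPred_eq]
              omega
            rw [← ofReal_measureReal, ← h4, h3]
            exact ENNReal.ofReal_le_ofReal (sub_le_sub_left ((hQ.site i).ext y) 1)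
          have h5 : 0 ≤ 1 - c₀ y := sub_nonneg.2 (((hQ.site i).ext y).trans measureReal_le_one)
          have h6 : 0 ≤ (y : ℝ) + e y := by
            rw [← (hQ.site i).mean y, integral_sub ((hQ.site i).integrable hθ y)
              (integrable_const _)]
            have : 0 ≤ ∫ ω, (Q i ω y : ℝ) ∂P := integral_nonneg fun ω => Nat.cast_nonneg _
            simpa using this
          rw [if_pos (show 1 ≤ y from hy), lintegral_add_right _ measurable_const]
          simp only [g]
          have h7 : Measurable fun ω => ENNReal.ofReal (Q i ω y : ℝ) :=
            (measurable_of_countable fun k : ℕ => ENNReal.ofReal (k : ℝ)).comp hmy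
          rw [lintegral_add_left h7,
            (hQ.site i).lintegral_eq hθ, h1]
          simp only [lintegral_const, measure_univ, mul_one]
          rw [if_pos (show 1 ≤ y from hy)]
          calc _ ≤ ENNReal.ofReal (y + e y) + ENNReal.ofReal B * ENNReal.ofReal (1 - c₀ y) +
                ENNReal.ofReal (1 / 4) := by gcongr
            _ = ENNReal.ofReal (y + e y + B * (1 - c₀ y) + 1 / 4) := by
                rw [← ENNReal.ofReal_mul hB, ← ENNReal.ofReal_add h6 (by positivity),
                  ← ENNReal.ofReal_add (by positivity) (by positivity)]
            _ ≤ ENNReal.ofReal (y + B) := by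
                refine ENNReal.ofReal_le_ofReal ?_
                have := hBe y hy
                linarith
            _ = _ := ENNReal.ofReal_add (by positivity) hB)
    refine le_trans (le_of_eq ?_) h
    have hms : MeasurableSet {ω | 1 ≤ chain (fun j => Q j ω) n₀ m i} :=
      measurableSet_le measurable_const (hQ.measurable_chain n₀ m i)
    have hgm : Measurable fun ω => g (chain (fun j => Q j ω) n₀ m (i + 1)) :=
      (measurable_of_countable g).comp (hQ.measurable_chain n₀ m (i + 1))
    rw [← lintegral_indicator_const hms, ← lintegral_add_left hgm]
    refine lintegral_congr fun ω => ?_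
    rw [chain, bump, if_neg (by omega), Set.indicator_apply]
    rfl
  have hdec : ∀ i, m ≤ i → P {ω | 1 ≤ chain (fun j => Q j ω) n₀ m (i + 1)} ≤
      P {ω | 1 ≤ chain (fun j => Q j ω) n₀ m i} := by
    intro i hi
    refine measure_mono fun ω hω => ?_
    simp only [Set.mem_ofPred_eq] at hω ⊢
    by_contra hcon
    have := chain_eq_zero_of_le (hq0 ω) hi (by omega : chain (fun j => Q j ω) n₀ m i = 0)
      (Nat.le_add_right i 1)
    omega
  have hind : ∀ k : ℕ, ENNReal.ofReal (k / 4) *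
      P {ω | 1 ≤ chain (fun j => Q j ω) n₀ m (m + k)} +
      ∫⁻ ω, g (chain (fun j => Q j ω) n₀ m (m + k)) ∂P ≤
      ∫⁻ ω, g (chain (fun j => Q j ω) n₀ m m) ∂P := by
    intro k
    induction k with
    | zero => simp
    | succ k ih =>
      refine le_trans ?_ ih
      rw [← add_assoc m k 1]
      calc _ ≤ ENNReal.ofReal ((k + 1 : ℕ) / 4) *
            P {ω | 1 ≤ chain (fun j => Q j ω) n₀ m (m + k)} +
            ∫⁻ ω, g (chain (fun j => Q j ω) n₀ m (m + k + 1)) ∂P := by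
            have := hdec (m + k) (by omega)
            gcongr _ * ?_ + _
        _ = ENNReal.ofReal (k / 4) * P {ω | 1 ≤ chain (fun j => Q j ω) n₀ m (m + k)} +
            (∫⁻ ω, g (chain (fun j => Q j ω) n₀ m (m + k + 1)) ∂P +
            ENNReal.ofReal (1 / 4) * P {ω | 1 ≤ chain (fun j => Q j ω) n₀ m (m + k)}) := by
            rw [show (((k + 1 : ℕ) : ℝ) / 4) = k / 4 + 1 / 4 by push_cast; ring,
              ENNReal.ofReal_add (by positivity) (by positivity)]
            ring
        _ ≤ _ := by
            gcongr
            exact hstep (m + k) (by omega)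
  calc _ ≤ _ := le_self_add
    _ ≤ _ := hind k
    _ ≤ ∫⁻ ω, (ENNReal.ofReal (chain (fun j => Q j ω) n₀ m m) + ENNReal.ofReal B) ∂P := by
        refine lintegral_mono fun ω => ?_
        simp only [g]
        gcongr
        split_ifs <;> simp
    _ ≤ ENNReal.ofReal (n₀ + m * (1 + D)) + ENNReal.ofReal B := by
        rw [lintegral_add_right _ measurable_const]
        simp only [lintegral_const, measure_univ, mul_one]
        gcongr
        exact hQ.lintegral_chain hθ hD he n₀ m m
    _ = _ := (ENNReal.ofReal_add (by positivity) hB).symm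

end ChainBounds

/-- The deterministic profile followed by the chain. -/
def profile (n₀ m i : ℕ) : ℝ := max ((n₀ : ℝ) + (min i m : ℕ) - i / 2) 0

theorem chain_eq_fluct_add (e : ℕ → ℝ) (q : ℕ → ℕ → ℕ) (n₀ m i : ℕ) :
    (chain q n₀ m (i + 1) : ℝ) - fluct e q n₀ m (i + 1) = chain q n₀ m i - fluct e q n₀ m i +
      bump m i + e (chain q n₀ m i + bump m i) := by
  rw [fluct, chain]
  push_cast
  ring

theorem min_succ_eq_add_bump (m i : ℕ) :
    ((min (i + 1) m : ℕ) : ℝ) = (min i m : ℕ) + bump m i := by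
  unfold bump
  norm_cast
  split_ifs <;> omega

theorem abs_chain_sub_profile_le {e : ℕ → ℝ} {q : ℕ → ℕ → ℕ} {n₀ m N n₁ : ℕ} {D δ d : ℝ}
    (hq : ∀ i, q i 0 = 0) (hD : 0 ≤ D) (hδ : 0 ≤ δ) (he : ∀ n, -1 / 2 ≤ e n) (heD : ∀ n, e n ≤ D)
    (heδ : ∀ n, n₁ ≤ n → e n ≤ -1 / 2 + δ) (hmN : m ≤ N) (h0 : chain q n₀ m N = 0)
    (hd : ∀ i ≤ N, |fluct e q n₀ m i| ≤ d) (i : ℕ) :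
    |(chain q n₀ m i : ℝ) - profile n₀ m i| ≤ n₁ + D + 2 * d + δ * N := by
  have hd0 : 0 ≤ d := (abs_nonneg _).trans (hd 0 (Nat.zero_le _))
  have hb : ∀ i, (0 : ℝ) ≤ bump m i := fun i => Nat.cast_nonneg _
  have hlow : ∀ i, (n₀ : ℝ) + (min i m : ℕ) - i / 2 ≤ chain q n₀ m i - fluct e q n₀ m i := by
    intro i
    induction i with
    | zero => simp [chain, fluct]
    | succ i ih =>
      rw [chain_eq_fluct_add, min_succ_eq_add_bump]
      have := he (chain q n₀ m i + bump m i)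
      push_cast
      push_cast at ih
      linarith
  have hup : ∀ i ≤ N, (chain q n₀ m i : ℝ) - fluct e q n₀ m i ≤
      profile n₀ m i + (n₁ + D + d) + δ * i := by
    intro i
    induction i with
    | zero =>
      intro _
      have : (n₀ : ℝ) ≤ profile n₀ m 0 := by simp [profile]
      have h1 : (0 : ℝ) ≤ n₁ := Nat.cast_nonneg _
      simp only [chain, fluct, Nat.cast_zero, mul_zero]
      linarith
    | succ i ih =>
      intro hi
      have ih' := ih (by omega)
      have hδi : 0 ≤ δ * i := by positivity
      rw [chain_eq_fluct_add]
      push_cast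
      by_cases hn : n₁ ≤ chain q n₀ m i + bump m i
      · have h1 := heδ _ hn
        have h2 : profile n₀ m i + bump m i - 1 / 2 ≤ profile n₀ m (i + 1) := by
          unfold profile
          rw [min_succ_eq_add_bump]
          by_cases him : i < m
          · have h3 : (0 : ℝ) ≤ (n₀ : ℝ) + (min i m : ℕ) - i / 2 := by
              rw [min_eq_left him.le]
              have : (0 : ℝ) ≤ i := Nat.cast_nonneg _
              have : (0 : ℝ) ≤ n₀ := Nat.cast_nonneg _
              linarith
            rw [max_eq_left h3]
            refine le_trans (le_of_eq ?_) (le_max_left _ _)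
            push_cast
            ring
          · have h3 : (bump m i : ℝ) = 0 := by simp [bump, him]
            rw [h3]
            rcases max_cases ((n₀ : ℝ) + (min i m : ℕ) - i / 2) 0 with h | h
            · rw [h.1]
              refine le_trans (le_of_eq ?_) (le_max_left _ _)
              push_cast
              ring
            · rw [h.1]
              refine le_trans ?_ (le_max_right _ _)
              norm_num
        linarith
      · have h1 := heD (chain q n₀ m i + bump m i)
        have h2 : (chain q n₀ m i : ℝ) + bump m i ≤ n₁ := by
          norm_cast
          omega
        have h3 : 0 ≤ profile n₀ m (i + 1) := le_max_right _ _
        have h4 := (abs_le.1 (hd i (by omega))).1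
        linarith
  have hn₁ : (0 : ℝ) ≤ n₁ := Nat.cast_nonneg _
  have hδN : 0 ≤ δ * N := by positivity
  have hY : (0 : ℝ) ≤ chain q n₀ m i := Nat.cast_nonneg _
  rcases le_or_gt i N with hi | hi
  · have h1 := abs_le.1 (hd i hi)
    have h2 := hup i hi
    have h3 : δ * i ≤ δ * N := by gcongr
    have h4 : profile n₀ m i ≤ chain q n₀ m i + d :=
      max_le (by linarith [hlow i]) (by linarith)
    rw [abs_le]
    constructor <;> linarith
  · rw [chain_eq_zero_of_le hq hmN h0 hi.le]
    have h1 := abs_le.1 (hd N le_rfl)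
    have h2 := hlow N
    rw [h0, min_eq_right hmN] at h2
    have h3 : profile n₀ m i ≤ d := by
      refine max_le ?_ hd0
      rw [min_eq_right (hmN.trans hi.le)]
      have : (N : ℝ) ≤ i := by exact_mod_cast hi.le
      push_cast at h2
      linarith
    have h4 : 0 ≤ profile n₀ m i := le_max_right _ _
    rw [Nat.cast_zero, zero_sub, abs_neg, abs_of_nonneg h4]
    linarith

/-- The chain dies out after the bumps have stopped and stays close to its profile. -/
def ChainClose (q : ℕ → ℕ → ℕ) (n₀ m : ℕ) (a : ℝ) : Prop :=
  (∃ k, m ≤ k ∧ chain q n₀ m k = 0) ∧ ∀ i, |(chain q n₀ m i : ℝ) - profile n₀ m i| ≤ a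

theorem eventually_exp_bound (K : ℝ) {l η : ℝ} (hl : 0 < l) (hη : 0 < η) :
    ∀ᶠ A : ℝ in atTop, (K * A + 1) * (2 * Real.exp (-(l * A))) ≤ η := by
  have h1 : Tendsto (fun A : ℝ => A * Real.exp (-(l * A))) atTop (𝓝 0) := by
    have := Real.tendsto_pow_mul_exp_neg_atTop_nhds_zero 1
    have h2 := (this.comp (tendsto_id.const_mul_atTop hl)).const_mul l⁻¹
    rw [mul_zero] at h2
    refine h2.congr fun A => ?_
    simp only [Function.comp, id, pow_one]
    field_simp
  have h2 : Tendsto (fun A : ℝ => Real.exp (-(l * A))) atTop (𝓝 0) :=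
    Real.tendsto_exp_neg_atTop_nhds_zero.comp (tendsto_id.const_mul_atTop hl)
  have h3 : Tendsto (fun A : ℝ => (K * A + 1) * (2 * Real.exp (-(l * A)))) atTop (𝓝 0) := by
    have := (h1.const_mul (2 * K)).add (h2.const_mul 2)
    simp only [mul_zero, add_zero] at this
    refine this.congr fun A => by ring
  exact h3.eventually (eventually_le_nhds hη)

theorem exists_const_drift {e c₀ : ℕ → ℝ} (het : Tendsto e atTop (𝓝 (-1 / 2)))
    (hc : ∀ n, 0 < c₀ n) : ∃ B : ℝ, 0 ≤ B ∧ ∀ n, 1 ≤ n → e n + 1 / 4 ≤ B * c₀ n := by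
  obtain ⟨n₁, hn₁⟩ := eventually_atTop.1
    (het.eventually (eventually_le_nhds (show (-1 / 2 : ℝ) < -1 / 4 by norm_num)))
  have h0 : ∀ n, 0 ≤ (|e n| + 1) / c₀ n := fun n => div_nonneg (by positivity) (hc n).le
  have hB : 0 ≤ ∑ n ∈ Finset.range n₁, (|e n| + 1) / c₀ n := Finset.sum_nonneg fun n _ => h0 n
  refine ⟨_, hB, fun n _ => ?_⟩
  rcases le_or_gt n₁ n with h | h
  · have := hn₁ n h
    have := mul_nonneg hB (hc n).le
    linarith
  · have h1 := Finset.single_le_sum (f := fun n => (|e n| + 1) / c₀ n) (fun n _ => h0 n)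
      (Finset.mem_range.2 h)
    have h2 := mul_le_mul_of_nonneg_right h1 (hc n).le
    simp only [div_mul_cancel₀ _ (hc n).ne'] at h2
    have := le_abs_self (e n)
    linarith

theorem exists_prob_not_chainClose_le {Ω : Type*} [MeasurableSpace Ω] (P : Measure Ω)
    [IsProbabilityMeasure P] {θ C : ℝ} (hθ : 0 < θ) (hC : 0 < C) {e c₀ : ℕ → ℝ}
    (he : ∀ n, -1 / 2 ≤ e n) (het : Tendsto e atTop (𝓝 (-1 / 2))) (hc : ∀ n, 0 < c₀ n)
    {M ε η : ℝ} (hM : 0 < M) (hε : 0 < ε) (hη : 0 < η) :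
    ∃ A₀ : ℝ, ∀ A ≥ A₀, ∀ Q : ℕ → Ω → ℕ → ℕ, ChainLaw P θ C e c₀ Q →
      ∀ n₀ m : ℕ, (n₀ : ℝ) ≤ M * A → (m : ℝ) ≤ M * A →
        P {ω | ¬ ChainClose (fun j => Q j ω) n₀ m (ε * A)} ≤ ENNReal.ofReal η := by
  obtain ⟨B, hB, hBe⟩ := exists_const_drift het hc
  set D : ℝ := C / θ with hDdef
  have hD : 0 < D := div_pos hC hθ
  set V : ℝ := varBound θ C with hVdef
  have hV : 0 < V := by rw [hVdef, varBound]; positivity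
  set S : ℝ := M + M * (1 + D) + 1 with hS
  have hS0 : 0 < S := by positivity
  set K' : ℝ := 8 * S / η with hK'
  have hK'0 : 0 < K' := by positivity
  set K : ℝ := M + K' + 1 with hK
  have hK0 : 0 < K := by positivity
  set δ : ℝ := ε / (4 * K) with hδ
  have hδ0 : 0 < δ := by positivity
  obtain ⟨n₁, hn₁⟩ := eventually_atTop.1
    (het.eventually (eventually_le_nhds (show (-1 / 2 : ℝ) < -1 / 2 + δ by linarith)))
  set s : ℝ := min (θ / 2) (ε / (16 * V * K)) with hs
  have hs0 : 0 < s := lt_min (by positivity) (by positivity)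
  have hsθ : s ≤ θ / 2 := min_le_left _ _
  have hsV : V * s * K ≤ ε / 16 := by
    have h1 : s ≤ ε / (16 * V * K) := min_le_right _ _
    rw [le_div_iff₀ (by positivity)] at h1
    linarith
  obtain ⟨A₁, hA₁⟩ := eventually_atTop.1
    (eventually_exp_bound K (show 0 < s * ε / 16 by positivity) (half_pos hη))
  refine ⟨max (max 1 A₁) (max B ((n₁ + D) * 4 / ε)), fun A hA Q hQ n₀ m hn₀ hm => ?_⟩
  have hA1 : 1 ≤ A := ((le_max_left _ _).trans (le_max_left _ _)).trans hA
  have hAA : A₁ ≤ A := ((le_max_right _ _).trans (le_max_left _ _)).trans hA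
  have hAB : B ≤ A := ((le_max_left _ _).trans (le_max_right _ _)).trans hA
  have hAn : (n₁ + D) * 4 / ε ≤ A := ((le_max_right _ _).trans (le_max_right _ _)).trans hA
  have hA0 : 0 < A := by linarith
  have heD : ∀ n, e n ≤ D := fun n => (le_abs_self _).trans ((hQ.site 0).abs_mean_le hθ n)
  set k : ℕ := ⌈K' * A⌉₊ with hk
  have hk1 : K' * A ≤ k := Nat.le_ceil _
  have hk2 : (k : ℝ) < K' * A + 1 := Nat.ceil_lt_add_one (by positivity)
  have hN : ((m + k : ℕ) : ℝ) ≤ K * A := by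
    push_cast
    rw [hK]
    nlinarith
  have hk0 : (0 : ℝ) < k := lt_of_lt_of_le (by positivity) hk1
  have hext : P {ω | 1 ≤ chain (fun j => Q j ω) n₀ m (m + k)} ≤ ENNReal.ofReal (η / 2) := by
    have h := hQ.prob_alive_mul_le hθ hB hBe hD.le heD n₀ m k
    have h2 : ENNReal.ofReal (n₀ + m * (1 + D) + B) ≤
        ENNReal.ofReal (k / 4) * ENNReal.ofReal (η / 2) := by
      rw [← ENNReal.ofReal_mul (by positivity)]
      refine ENNReal.ofReal_le_ofReal ?_
      have h3 : (m : ℝ) * (1 + D) ≤ M * A * (1 + D) := by gcongr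
      have h4 : K' * η = 8 * S := by rw [hK']; field_simp
      have h5 : K' * A * η ≤ k * η := by gcongr
      have h6 : K' * A * η = 8 * S * A := by rw [← h4]; ring
      rw [hS] at h6
      nlinarith
    have h3 := h.trans h2
    exact (ENNReal.mul_le_mul_iff_right (by simpa using hk0) ENNReal.ofReal_ne_top).1 h3
  have hfl : P (⋃ i ∈ Finset.range (m + k + 1),
      {ω | ε * A / 8 < |fluct e (fun j => Q j ω) n₀ m i|}) ≤ ENNReal.ofReal (η / 2) := by
    refine (measure_biUnion_finset_le _ _).trans ?_
    have h1 : ∀ i ∈ Finset.range (m + k + 1),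
        P {ω | ε * A / 8 < |fluct e (fun j => Q j ω) n₀ m i|} ≤
          ENNReal.ofReal (2 * Real.exp (-(s * ε / 16 * A))) := by
      intro i hi
      refine (hQ.prob_lt_fluct hθ n₀ m hs0.le hsθ i _).trans (ENNReal.ofReal_le_ofReal ?_)
      have hi' : (i : ℝ) ≤ K * A := by
        refine le_trans ?_ hN
        exact_mod_cast Nat.lt_succ_iff.1 (Finset.mem_range.1 hi)
      have h2 : V * s ^ 2 * i ≤ V * s ^ 2 * (K * A) := by gcongr
      have h3 : V * s ^ 2 * (K * A) = (V * s * K) * (s * A) := by ring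
      have h4 : (V * s * K) * (s * A) ≤ ε / 16 * (s * A) := by gcongr
      gcongr
      linarith
    refine (Finset.sum_le_card_nsmul _ _ _ h1).trans ?_
    rw [Finset.card_range, nsmul_eq_mul, ← ENNReal.ofReal_natCast,
      ← ENNReal.ofReal_mul (by positivity)]
    refine ENNReal.ofReal_le_ofReal (le_trans ?_ (hA₁ A hAA))
    gcongr
    rw [Nat.cast_add_one]
    linarith
  refine (measure_mono (t := {ω | 1 ≤ chain (fun j => Q j ω) n₀ m (m + k)} ∪
    ⋃ i ∈ Finset.range (m + k + 1), {ω | ε * A / 8 < |fluct e (fun j => Q j ω) n₀ m i|})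
    fun ω hω => ?_).trans ((measure_union_le _ _).trans ?_)
  · by_contra hcon
    simp only [Set.mem_union, Set.mem_ofPred_eq, Set.mem_iUnion, not_or, not_exists, not_lt,
      not_le, Finset.mem_range, Nat.lt_succ_iff] at hcon
    obtain ⟨h0, hd⟩ := hcon
    have h0' : chain (fun j => Q j ω) n₀ m (m + k) = 0 := by omega
    refine hω ⟨⟨m + k, Nat.le_add_right _ _, h0'⟩, fun i => ?_⟩
    refine (abs_chain_sub_profile_le (fun i => (hQ.site i).zero ω) hD.le hδ0.le he heD hn₁
      (Nat.le_add_right _ _) h0' hd i).trans ?_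
    have h1 : δ * ((m + k : ℕ) : ℝ) ≤ δ * (K * A) := by gcongr
    have h2 : δ * (K * A) = ε * A / 4 := by rw [hδ]; field_simp
    have h3 : (n₁ + D) ≤ ε * A / 4 := by
      rw [div_le_iff₀ hε] at hAn
      linarith
    linarith
  · calc _ ≤ ENNReal.ofReal (η / 2) + ENNReal.ofReal (η / 2) := add_le_add hext hfl
      _ = ENNReal.ofReal η := by rw [← ENNReal.ofReal_add (by positivity) (by positivity)]; ring_nf

theorem dirLocP_succ (x : ℕ → ℤ) (n : ℕ) (k : ℤ) :
    dirLocP x (n + 1) k = dirLocP x n k + if x n = k ∧ x (n + 1) = k + 1 then 1 else 0 := by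
  unfold dirLocP
  rw [Finset.range_add_one, Finset.filter_insert]
  split_ifs with h
  · rw [Finset.card_insert_of_notMem (by simp)]
  · rfl

theorem dirLocM_succ (x : ℕ → ℤ) (n : ℕ) (k : ℤ) :
    dirLocM x (n + 1) k = dirLocM x n k + if x n = k ∧ x (n + 1) = k - 1 then 1 else 0 := by
  unfold dirLocM
  rw [Finset.range_add_one, Finset.filter_insert]
  split_ifs with h
  · rw [Finset.card_insert_of_notMem (by simp)]
  · rfl

@[simp] theorem dirLocP_zero (x : ℕ → ℤ) (k : ℤ) : dirLocP x 0 k = 0 := rfl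

@[simp] theorem dirLocM_zero (x : ℕ → ℤ) (k : ℤ) : dirLocM x 0 k = 0 := rfl

theorem counting_dirLocP (x : ℕ → ℤ) (k : ℤ) : Counting fun n => dirLocP x n k := by
  refine ⟨rfl, fun m => ?_, fun m => ?_⟩ <;> rw [dirLocP_succ] <;>
    split_ifs <;> omega

/-- The number of departures from `k` before time `n`. -/
def departures (x : ℕ → ℤ) (n : ℕ) (k : ℤ) : ℕ := dirLocP x n k + dirLocM x n k

/-- A nearest-neighbour path started at `0` whose first `m` departures from the site `k` consist of
`a k m` steps to the right and `b k m` steps to the left. -/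
structure StackPath (x : ℕ → ℤ) (a b : ℤ → ℕ → ℕ) : Prop where
  zero : x 0 = 0
  step : ∀ n, x (n + 1) = x n + 1 ∨ x (n + 1) = x n - 1
  right : ∀ k, Counting (a k)
  left : ∀ k, Counting (b k)
  add : ∀ k m, a k m + b k m = m
  plus : ∀ n k, dirLocP x n k = a k (departures x n k)
  minus : ∀ n k, dirLocM x n k = b k (departures x n k)
  unbounded_right : ∀ k n, ∃ m, n ≤ a k m
  unbounded_left : ∀ k n, ∃ m, n ≤ b k m

namespace StackPath

variable {x : ℕ → ℤ} {a b : ℤ → ℕ → ℕ}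

theorem departures_succ (hx : StackPath x a b) (n : ℕ) (k : ℤ) :
    departures x (n + 1) k = departures x n k + if x n = k then 1 else 0 := by
  rw [departures, departures, dirLocP_succ, dirLocM_succ]
  have := hx.step n
  split_ifs <;> omega

theorem conservation (hx : StackPath x a b) (n : ℕ) (k : ℤ) :
    (dirLocP x n k : ℤ) - dirLocM x n (k + 1) =
      (if 0 ≤ k ∧ k < x n then 1 else 0) - (if x n ≤ k ∧ k < 0 then 1 else 0) := by
  induction n with
  | zero =>
    rw [hx.zero]
    simp only [dirLocP_zero, dirLocM_zero]
    split_ifs <;> omega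
  | succ n ih =>
    rw [dirLocP_succ, dirLocM_succ]
    have := hx.step n
    push_cast
    split_ifs at ih ⊢ <;> omega

theorem left_hit (hx : StackPath x a b) (k : ℤ) (n : ℕ) :
    b k (hit (b k) n) = n ∧ a k (hit (b k) n) = other (b k) n := by
  have h1 := (hx.left k).apply_hit (hx.unbounded_left k n)
  have h2 := (hx.left k).hit_eq (hx.unbounded_left k n)
  have h3 := hx.add k (hit (b k) n)
  omega

theorem right_hit (hx : StackPath x a b) (k : ℤ) (n : ℕ) :
    a k (hit (a k) n) = n ∧ b k (hit (a k) n) = other (a k) n := by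
  have h1 := (hx.right k).apply_hit (hx.unbounded_right k n)
  have h2 := (hx.right k).hit_eq (hx.unbounded_right k n)
  have h3 := hx.add k (hit (a k) n)
  omega

end StackPath

/-- The chain of upcrossings of the edges to the right of `j`. -/
def rightChain (b : ℤ → ℕ → ℕ) (j : ℤ) (r i : ℕ) : ℕ :=
  chain (fun i => other (b (j + 1 + i))) (r - 1) (-j).toNat i

/-- The initial state of `leftChain`. -/
def leftStart (j : ℤ) (r : ℕ) : ℕ := r - if 0 ≤ j then 1 else 0

/-- The chain of downcrossings of the edges to the left of `j`. -/
def leftChain (a : ℤ → ℕ → ℕ) (j : ℤ) (r i : ℕ) : ℕ :=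
  chain (fun i => other (a (j - i))) (leftStart j r) (j + 1).toNat i

/-- The number of departures from `k` by the time of the `r`-th step from `j` to `j + 1`. -/
def target (a b : ℤ → ℕ → ℕ) (j : ℤ) (r : ℕ) (k : ℤ) : ℕ :=
  if j < k then hit (b k) (rightChain b j r (k - j - 1).toNat + bump (-j).toNat (k - j - 1).toNat)
  else hit (a k) (leftChain a j r (j - k).toNat + bump (j + 1).toNat (j - k).toNat)

theorem target_right (a b : ℤ → ℕ → ℕ) (j : ℤ) (r i : ℕ) :
    target a b j r (j + 1 + i) =
      hit (b (j + 1 + i)) (rightChain b j r i + bump (-j).toNat i) := by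
  have h : (j + 1 + i - j - 1).toNat = i := by omega
  rw [target, if_pos (by omega), h]

theorem target_left (a b : ℤ → ℕ → ℕ) (j : ℤ) (r i : ℕ) :
    target a b j r (j - i) =
      hit (a (j - i)) (leftChain a j r i + bump (j + 1).toNat i) := by
  have h : (j - (j - i)).toNat = i := by omega
  rw [target, if_neg (by omega), h]

theorem rightChain_succ (b : ℤ → ℕ → ℕ) (j : ℤ) (r i : ℕ) :
    rightChain b j r (i + 1) =
      other (b (j + 1 + i)) (rightChain b j r i + bump (-j).toNat i) := rfl

theorem leftChain_succ (a : ℤ → ℕ → ℕ) (j : ℤ) (r i : ℕ) :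
    leftChain a j r (i + 1) =
      other (a (j - i)) (leftChain a j r i + bump (j + 1).toNat i) := rfl

theorem leftChain_zero_add {a : ℤ → ℕ → ℕ} {j : ℤ} {r : ℕ} (hr : 1 ≤ r) :
    leftChain a j r 0 + bump (j + 1).toNat 0 = r := by
  rw [leftChain, chain, leftStart, bump]
  split_ifs <;> omega

namespace StackPath

variable {x : ℕ → ℤ} {a b : ℤ → ℕ → ℕ} {j : ℤ} {r : ℕ}

theorem target_right_counts (hx : StackPath x a b) (j : ℤ) (r i : ℕ) :
    b (j + 1 + i) (target a b j r (j + 1 + i)) = rightChain b j r i + bump (-j).toNat i ∧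
      a (j + 1 + i) (target a b j r (j + 1 + i)) = rightChain b j r (i + 1) := by
  rw [target_right, rightChain_succ]
  exact hx.left_hit _ _

theorem target_left_counts (hx : StackPath x a b) (j : ℤ) (r i : ℕ) :
    a (j - i) (target a b j r (j - i)) = leftChain a j r i + bump (j + 1).toNat i ∧
      b (j - i) (target a b j r (j - i)) = leftChain a j r (i + 1) := by
  rw [target_left, leftChain_succ]
  exact hx.right_hit _ _

/-- The least action principle: no site is left more often than prescribed by `target`. -/
theorem departures_le_target (hx : StackPath x a b) (hr : 1 ≤ r) (n : ℕ)
    (hn : ∀ i < n, dirLocP x i j < r) (k : ℤ) : departures x n k ≤ target a b j r k := by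
  induction n generalizing k with
  | zero => exact Nat.zero_le _
  | succ n ih =>
    have ih := ih fun i hi => hn i (by omega)
    have hnr := hn n (by omega)
    rw [hx.departures_succ]
    split_ifs with hk
    swap
    · exact ih k
    refine Nat.succ_le_of_lt (lt_of_le_of_ne (ih k) fun heq => ?_)
    have hP := hx.plus n k
    have hM := hx.minus n k
    rw [heq] at hP hM
    rcases lt_or_ge j k with hjk | hjk
    · obtain ⟨i, rfl⟩ : ∃ i : ℕ, k = j + 1 + i := ⟨(k - j - 1).toNat, by omega⟩
      obtain ⟨h1, h2⟩ := hx.target_right_counts j r i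
      have h3 := hx.conservation n (j + i)
      rw [show j + i + 1 = j + 1 + i by ring] at h3
      rw [hM, h1, hk] at h3
      have h4 : dirLocP x n (j + i) ≤ rightChain b j r i := by
        cases i with
        | zero =>
          simp only [Nat.cast_zero, add_zero]
          rw [rightChain, chain]
          omega
        | succ i =>
          have h5 := (hx.right (j + 1 + i)).mono (ih (j + 1 + i))
          rw [(hx.target_right_counts j r i).2, ← hx.plus] at h5
          rwa [show j + ((i + 1 : ℕ) : ℤ) = j + 1 + i by push_cast; ring]
      unfold bump at h3
      push_cast at h3
      split_ifs at h3 <;> omega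
    · obtain ⟨i, rfl⟩ : ∃ i : ℕ, k = j - i := ⟨(j - k).toNat, by omega⟩
      obtain ⟨h1, h2⟩ := hx.target_left_counts j r i
      cases i with
      | zero =>
        rw [leftChain_zero_add hr] at h1
        simp only [Nat.cast_zero, sub_zero] at *
        omega
      | succ i =>
        have h3 := hx.conservation n (j - (i + 1 : ℕ))
        have h5 := (hx.left (j - i)).mono (ih (j - i))
        rw [(hx.target_left_counts j r i).2, ← hx.minus] at h5
        rw [show j - ((i + 1 : ℕ) : ℤ) + 1 = j - i by push_cast; ring, hP, h1, hk] at h3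
        unfold bump at h3
        push_cast at h3
        split_ifs at h3 <;> omega

theorem sum_departures (hx : StackPath x a b) (F : Finset ℤ) (n : ℕ) (hF : ∀ i < n, x i ∈ F) :
    ∑ k ∈ F, departures x n k = n := by
  induction n with
  | zero => simp [departures]
  | succ n ih =>
    simp only [hx.departures_succ, Finset.sum_add_distrib]
    rw [ih fun i hi => hF i (by omega), Finset.sum_ite_eq, if_pos (hF n (by omega))]

theorem exists_le_dirLocP (hx : StackPath x a b) (hr : 1 ≤ r) {k₁ k₂ : ℕ}
    (hk₁ : (-j).toNat ≤ k₁) (h₁ : rightChain b j r k₁ = 0)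
    (hk₂ : (j + 1).toNat ≤ k₂) (h₂ : leftChain a j r k₂ = 0) : ∃ n, r ≤ dirLocP x n j := by
  by_contra! hcon
  have hle := fun n k => hx.departures_le_target hr n (fun i _ => hcon i) k
  have hR : ∀ i, k₁ ≤ i → target a b j r (j + 1 + i) = 0 := by
    intro i hi
    have h := chain_eq_zero_of_le (fun i => other_zero _) hk₁ h₁ hi
    rw [target_right, rightChain, h, bump, if_neg (by omega)]
    simp [hit]
  have hL : ∀ i, k₂ ≤ i → target a b j r (j - i) = 0 := by
    intro i hi
    have h := chain_eq_zero_of_le (fun i => other_zero _) hk₂ h₂ hi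
    rw [target_left, leftChain, h, bump, if_neg (by omega)]
    simp [hit]
  have hF : ∀ n, x n ∈ Finset.Icc (j - k₂) (j + 1 + k₁) := by
    intro n
    have h1 := hle (n + 1) (x n)
    rw [hx.departures_succ, if_pos rfl] at h1
    rw [Finset.mem_Icc]
    constructor
    · by_contra! hlt
      have h2 := hL (j - x n).toNat (by omega)
      rw [show j - ((j - x n).toNat : ℤ) = x n by omega] at h2
      omega
    · by_contra! hlt
      have h2 := hR (x n - j - 1).toNat (by omega)
      rw [show j + 1 + ((x n - j - 1).toNat : ℤ) = x n by omega] at h2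
      omega
  have h := hx.sum_departures _ (∑ k ∈ Finset.Icc (j - k₂) (j + 1 + k₁), target a b j r k + 1)
    fun i _ => hF i
  have h' := Finset.sum_le_sum (s := Finset.Icc (j - (k₂ : ℤ)) (j + 1 + k₁)) fun k _ =>
    hle (∑ k ∈ Finset.Icc (j - k₂) (j + 1 + k₁), target a b j r k + 1) k
  omega

theorem local_times_at_hitting (hx : StackPath x a b) (hr : 1 ≤ r)
    (hfin : ∃ n, r ≤ dirLocP x n j) :
    (∀ i : ℕ, dirLocP x (Tp x j r) (j + 1 + i) = rightChain b j r (i + 1) ∧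
      dirLocM x (Tp x j r) (j + 1 + i) = rightChain b j r i + bump (-j).toNat i) ∧
    dirLocP x (Tp x j r) j = r ∧
    ∀ i : ℕ, dirLocP x (Tp x j r) (j - i) = leftChain a j r i + bump (j + 1).toNat i ∧
      dirLocM x (Tp x j r) (j - i) = leftChain a j r (i + 1) := by
  have hT : dirLocP x (Tp x j r) j = r := (counting_dirLocP x j).apply_hit hfin
  have hlt : ∀ i < Tp x j r, dirLocP x i j < r := fun i hi => by
    by_contra! h
    exact absurd (Nat.sInf_le (s := {n | r ≤ dirLocP x n j}) h) (not_le.2 hi)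
  have hle := hx.departures_le_target hr _ hlt
  have hpos : x (Tp x j r) = j + 1 := by
    obtain ⟨t, ht⟩ : ∃ t, Tp x j r = t + 1 := by
      refine Nat.exists_eq_succ_of_ne_zero fun h0 => ?_
      rw [h0] at hT
      simp at hT
      omega
    have h1 := hlt t (by omega)
    rw [ht, dirLocP_succ] at hT
    rw [ht]
    split_ifs at hT with h
    · exact h.2
    · omega
  generalize Tp x j r = T at *
  have hRstep : ∀ i : ℕ, dirLocM x T (j + 1 + i) = rightChain b j r i + bump (-j).toNat i →
      dirLocP x T (j + 1 + i) = rightChain b j r (i + 1) := by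
    intro i hi
    have h1 : target a b j r (j + 1 + i) ≤ departures x T (j + 1 + i) := by
      rw [target_right, (hx.left _).hit_le_iff (hx.unbounded_left _ _), ← hx.minus, hi]
    rw [hx.plus, le_antisymm (hle _) h1, (hx.target_right_counts j r i).2]
  have hLstep : ∀ i : ℕ, dirLocP x T (j - i) = leftChain a j r i + bump (j + 1).toNat i →
      dirLocM x T (j - i) = leftChain a j r (i + 1) := by
    intro i hi
    have h1 : target a b j r (j - i) ≤ departures x T (j - i) := by
      rw [target_left, (hx.right _).hit_le_iff (hx.unbounded_right _ _), ← hx.plus, hi]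
    rw [hx.minus, le_antisymm (hle _) h1, (hx.target_left_counts j r i).2]
  have hR : ∀ i : ℕ, dirLocM x T (j + 1 + i) = rightChain b j r i + bump (-j).toNat i := by
    intro i
    induction i with
    | zero =>
      have h := hx.conservation T j
      rw [hT, hpos] at h
      rw [rightChain, chain, bump]
      simp only [Nat.cast_zero, add_zero]
      split_ifs at h ⊢ <;> omega
    | succ i ih =>
      have h := hx.conservation T (j + 1 + i)
      rw [hRstep i ih, hpos] at h
      rw [show j + 1 + ((i + 1 : ℕ) : ℤ) = j + 1 + i + 1 by push_cast; ring, bump]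
      split_ifs at h ⊢ <;> omega
  have hL : ∀ i : ℕ, dirLocP x T (j - i) = leftChain a j r i + bump (j + 1).toNat i := by
    intro i
    induction i with
    | zero => simpa only [Nat.cast_zero, sub_zero, leftChain_zero_add hr] using hT
    | succ i ih =>
      have h := hx.conservation T (j - (i + 1 : ℕ))
      rw [show j - ((i + 1 : ℕ) : ℤ) + 1 = j - i by push_cast; ring, hLstep i ih, hpos] at h
      rw [bump]
      split_ifs at h ⊢ <;> omega
  exact ⟨fun i => ⟨hRstep i (hR i), hR i⟩, hT, fun i => ⟨hL i, hLstep i (hL i)⟩⟩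

end StackPath

theorem abs_two_mul_profile_right {j : ℤ} {r : ℕ} (hr : 1 ≤ r) (i : ℕ) :
    |2 * profile (r - 1) (-j).toNat i - max (|(j : ℝ)| - |((j + i : ℤ) : ℝ)| + 2 * r) 0| ≤ 2 := by
  have h : (2 * ((r - 1 : ℕ) : ℤ) + 2 * (min i (-j).toNat : ℕ) - i) + 2 =
      |j| - |j + i| + 2 * r := by
    rcases abs_cases j with h | h <;> rcases abs_cases (j + i) with h' | h' <;> omega
  have h' : (2 * ((r - 1 : ℕ) : ℝ) + 2 * (min i (-j).toNat : ℕ) - i) + 2 =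
      |(j : ℝ)| - |((j + i : ℤ) : ℝ)| + 2 * r := by exact_mod_cast h
  rw [← h', profile]
  rcases max_cases (((r - 1 : ℕ) : ℝ) + (min i (-j).toNat : ℕ) - i / 2) 0 with h1 | h1 <;>
  rcases max_cases ((2 * ((r - 1 : ℕ) : ℝ) + 2 * (min i (-j).toNat : ℕ) - i) + 2) 0 with h2 | h2 <;>
  rw [h1.1, h2.1, abs_le] <;> constructor <;> linarith

theorem abs_two_mul_profile_left {j : ℤ} {r : ℕ} (hr : 1 ≤ r) (i : ℕ) :
    |2 * profile (leftStart j r) (j + 1).toNat i -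
      max (|(j : ℝ)| - |((j - i : ℤ) : ℝ)| + 2 * r) 0| ≤ 2 := by
  have h : ∃ c : ℤ, 0 ≤ c ∧ c ≤ 2 ∧ (2 * (leftStart j r : ℤ) + 2 * (min i (j + 1).toNat : ℕ) - i) + c =
      |j| - |j - i| + 2 * r := by
    refine ⟨_, ?_, ?_, add_sub_cancel _ _⟩ <;> unfold leftStart <;>
    rcases abs_cases j with h | h <;> rcases abs_cases (j - i) with h' | h' <;> split_ifs <;> omega
  obtain ⟨c, hc0, hc2, h⟩ := h
  have h' : (2 * (leftStart j r : ℝ) + 2 * (min i (j + 1).toNat : ℕ) - i) + c =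
      |(j : ℝ)| - |((j - i : ℤ) : ℝ)| + 2 * r := by exact_mod_cast h
  have hc0' : (0 : ℝ) ≤ c := by exact_mod_cast hc0
  have hc2' : (c : ℝ) ≤ 2 := by exact_mod_cast hc2
  rw [← h', profile]
  rcases max_cases ((leftStart j r : ℝ) + (min i (j + 1).toNat : ℕ) - i / 2) 0 with h1 | h1 <;>
  rcases max_cases ((2 * (leftStart j r : ℝ) + 2 * (min i (j + 1).toNat : ℕ) - i) + c) 0
    with h2 | h2 <;>
  rw [h1.1, h2.1, abs_le] <;> constructor <;> linarith

theorem StackPath.abs_LamP_sub_le {x : ℕ → ℤ} {a b : ℤ → ℕ → ℕ} (hx : StackPath x a b) {j : ℤ}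
    {r : ℕ} (hr : 1 ≤ r) {d : ℝ}
    (hR : ChainClose (fun i => other (b (j + 1 + i))) (r - 1) (-j).toNat d)
    (hL : ChainClose (fun i => other (a (j - i))) (leftStart j r) (j + 1).toNat d) (k : ℤ) :
    |(LamP x j r k : ℝ) - max (|(j : ℝ)| - |(k : ℝ)| + 2 * r) 0| ≤ 2 * d + 4 := by
  obtain ⟨⟨k₁, hk₁, h₁⟩, hR⟩ := hR
  obtain ⟨⟨k₂, hk₂, h₂⟩, hL⟩ := hL
  obtain ⟨hr1, hrj, hl1⟩ := hx.local_times_at_hitting hr (hx.exists_le_dirLocP hr hk₁ h₁ hk₂ h₂)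
  have hb : ∀ m i, bump m i ≤ 1 := fun m i => by unfold bump; split_ifs <;> omega
  rcases le_or_gt j k with hjk | hjk
  · obtain ⟨i, rfl⟩ : ∃ i : ℕ, k = j + i := ⟨(k - j).toNat, by omega⟩
    have h : 2 * rightChain b j r i ≤ LamP x j r (j + i) ∧
        LamP x j r (j + i) ≤ 2 * rightChain b j r i + 2 := by
      have h1 := (hr1 i).2
      have h2 := hb (-j).toNat i
      rw [LamP, show j + (i : ℤ) + 1 = j + 1 + i by ring, h1]
      cases i with
      | zero =>
        simp only [Nat.cast_zero, add_zero, hrj]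
        rw [rightChain, chain]
        omega
      | succ i =>
        have h3 := (hr1 i).1
        rw [show j + ((i + 1 : ℕ) : ℤ) = j + 1 + i by push_cast; ring, h3]
        omega
    have h3 := abs_le.1 (hR i)
    have h4 := abs_le.1 (abs_two_mul_profile_right (j := j) hr i)
    have h5 : (2 : ℝ) * rightChain b j r i ≤ LamP x j r (j + i) := by exact_mod_cast h.1
    have h6 : (LamP x j r (j + i) : ℝ) ≤ 2 * rightChain b j r i + 2 := by exact_mod_cast h.2
    unfold rightChain at h5 h6
    rw [abs_le]
    constructor <;> linarith
  · obtain ⟨i, rfl⟩ : ∃ i : ℕ, k = j - (i + 1 : ℕ) := ⟨(j - k - 1).toNat, by omega⟩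
    have h : 2 * leftChain a j r (i + 1) ≤ LamP x j r (j - (i + 1 : ℕ)) ∧
        LamP x j r (j - (i + 1 : ℕ)) ≤ 2 * leftChain a j r (i + 1) + 1 := by
      have h1 := (hl1 (i + 1)).1
      have h2 := hb (j + 1).toNat (i + 1)
      rw [LamP, h1, show j - ((i + 1 : ℕ) : ℤ) + 1 = j - i by push_cast; ring, (hl1 i).2]
      omega
    have h3 := abs_le.1 (hL (i + 1))
    have h4 := abs_le.1 (abs_two_mul_profile_left (j := j) hr (i + 1))
    have h5 : (2 : ℝ) * leftChain a j r (i + 1) ≤ LamP x j r (j - (i + 1 : ℕ)) := by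
      exact_mod_cast h.1
    have h6 : (LamP x j r (j - (i + 1 : ℕ)) : ℝ) ≤ 2 * leftChain a j r (i + 1) + 1 := by
      exact_mod_cast h.2
    unfold leftChain at h5 h6
    rw [abs_le]
    constructor <;> linarith

/-- The number of visits to `k` before time `n`. -/
def visits (x : ℕ → ℤ) (n : ℕ) (k : ℤ) : ℕ := ((Finset.range n).filter fun i => x i = k).card

theorem visits_succ (x : ℕ → ℤ) (n : ℕ) (k : ℤ) :
    visits x (n + 1) k = visits x n k + if x n = k then 1 else 0 := by
  unfold visits
  rw [Finset.range_add_one, Finset.filter_insert]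
  split_ifs with h
  · rw [Finset.card_insert_of_notMem (by simp)]
  · rfl

theorem monotone_visits (x : ℕ → ℤ) (k : ℤ) : Monotone fun n => visits x n k :=
  monotone_nat_of_le_succ fun n => by rw [visits_succ]; exact Nat.le_add_right _ _

theorem visits_congr {x y : ℕ → ℤ} {n : ℕ} (h : ∀ i < n, x i = y i) (k : ℤ) :
    visits x n k = visits y n k := by
  unfold visits
  congr 1
  exact Finset.filter_congr fun i hi => by rw [h i (Finset.mem_range.1 hi)]

theorem dirLocP_congr {x y : ℕ → ℤ} {n : ℕ} (h : ∀ i ≤ n, x i = y i) (k : ℤ) :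
    dirLocP x n k = dirLocP y n k := by
  unfold dirLocP
  congr 1
  refine Finset.filter_congr fun i hi => ?_
  rw [Finset.mem_range] at hi
  rw [h i hi.le, h (i + 1) hi]

theorem dirLocM_congr {x y : ℕ → ℤ} {n : ℕ} (h : ∀ i ≤ n, x i = y i) (k : ℤ) :
    dirLocM x n k = dirLocM y n k := by
  unfold dirLocM
  congr 1
  refine Finset.filter_congr fun i hi => ?_
  rw [Finset.mem_range] at hi
  rw [h i hi.le, h (i + 1) hi]

theorem injective_visits (x : ℕ → ℤ) : Function.Injective fun i => (x i, visits x i (x i)) := by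
  have key : ∀ i i', i < i' → (x i, visits x i (x i)) ≠ (x i', visits x i' (x i')) := by
    intro i i' hlt heq
    rw [Prod.mk.injEq] at heq
    have h1 := monotone_visits x (x i') (Nat.succ_le_of_lt hlt)
    simp only [Nat.succ_eq_add_one, visits_succ, heq.1, if_true] at h1
    have h2 := heq.2
    rw [heq.1] at h2
    omega
  intro i i' h
  rcases lt_trichotomy i i' with h1 | h1 | h1
  · exact absurd h (key _ _ h1)
  · exact h1
  · exact absurd h.symm (key _ _ h1)

/-- Position and visit counts of the walk driven by the stacks `U`. -/
def stackState (p : ℤ → ℝ) (U : ℤ → ℕ → ℝ) : ℕ → ℤ × (ℤ → ℕ)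
  | 0 => (0, 0)
  | n + 1 =>
    let s := stackState p U n
    (s.1 + if U s.1 (s.2 s.1) < p (imb p (U s.1) (s.2 s.1)) then 1 else -1,
      Function.update s.2 s.1 (s.2 s.1 + 1))

/-- The walk driven by the stacks `U`. -/
def stackWalk (p : ℤ → ℝ) (U : ℤ → ℕ → ℝ) (n : ℕ) : ℤ := (stackState p U n).1

section Walk

variable (p : ℤ → ℝ) (U : ℤ → ℕ → ℝ)

theorem stackState_snd (n : ℕ) (k : ℤ) :
    (stackState p U n).2 k = visits (stackWalk p U) n k := by
  induction n generalizing k with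
  | zero => rfl
  | succ n ih =>
    rw [visits_succ, ← ih, stackState, stackWalk]
    dsimp only
    by_cases h : k = (stackState p U n).1
    · subst h; simp
    · rw [Function.update_of_ne h, if_neg (Ne.symm h), add_zero]

theorem stackWalk_succ' (n : ℕ) : stackWalk p U (n + 1) = stackWalk p U n +
    if U (stackWalk p U n) (visits (stackWalk p U) n (stackWalk p U n)) <
      p (imb p (U (stackWalk p U n)) (visits (stackWalk p U) n (stackWalk p U n)))
    then 1 else -1 := by
  rw [← stackState_snd]
  rfl

theorem dirLoc_stackWalk (n : ℕ) (k : ℤ) :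
    dirLocP (stackWalk p U) n k = rightCount p (U k) (visits (stackWalk p U) n k) ∧
      dirLocM (stackWalk p U) n k = leftCount p (U k) (visits (stackWalk p U) n k) := by
  induction n with
  | zero => exact ⟨rfl, rfl⟩
  | succ n ih =>
    have hs := stackWalk_succ' p U n
    rw [dirLocP_succ, dirLocM_succ, visits_succ, ih.1, ih.2]
    by_cases h : stackWalk p U n = k
    · rw [h] at hs
      have hle := rightCount_le p (U k) (visits (stackWalk p U) n k)
      rw [if_pos h, leftCount, leftCount, rightCount_succ]
      split_ifs at hs ⊢ <;> omega
    · simp [h]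

theorem stackWalk_succ (n : ℕ) : stackWalk p U (n + 1) = stackWalk p U n +
    if U (stackWalk p U n) (visits (stackWalk p U) n (stackWalk p U n)) <
      p ((dirLocP (stackWalk p U) n (stackWalk p U n) : ℤ) -
        dirLocM (stackWalk p U) n (stackWalk p U n))
    then 1 else -1 := by
  rw [stackWalk_succ', (dirLoc_stackWalk p U n _).1, (dirLoc_stackWalk p U n _).2]
  congr 4
  have := rightCount_le p (U (stackWalk p U n)) (visits (stackWalk p U) n (stackWalk p U n))
  rw [imb, leftCount]
  omega

variable {p U} in
theorem stackPath_stackWalk (hR : ∀ k n, ∃ m, n ≤ rightCount p (U k) m)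
    (hL : ∀ k n, ∃ m, n ≤ leftCount p (U k) m) :
    StackPath (stackWalk p U) (fun k => rightCount p (U k)) fun k => leftCount p (U k) := by
  have hadd : ∀ k m, rightCount p (U k) m + leftCount p (U k) m = m := fun k m => by
    have := rightCount_le p (U k) m
    rw [leftCount]
    omega
  have hdep : ∀ n k, departures (stackWalk p U) n k = visits (stackWalk p U) n k := fun n k => by
    rw [departures, (dirLoc_stackWalk p U n k).1, (dirLoc_stackWalk p U n k).2, hadd]
  refine ⟨rfl, fun n => ?_, fun k => counting_rightCount _ _, fun k => counting_leftCount _ _, hadd,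
    fun n k => ?_, fun n k => ?_, hR, hL⟩
  · rw [stackWalk_succ]
    split_ifs
    · exact Or.inl rfl
    · exact Or.inr rfl
  · rw [hdep, (dirLoc_stackWalk p U n k).1]
  · rw [hdep, (dirLoc_stackWalk p U n k).2]

end Walk

/-- The set of stack values which produce the step from `x n` to `x (n + 1)`. -/
def stepSet (p : ℤ → ℝ) (x : ℕ → ℤ) (n : ℕ) : Set ℝ :=
  if x (n + 1) = x n + 1 then
    Set.Iio (p ((dirLocP x n (x n) : ℤ) - dirLocM x n (x n)))
  else if x (n + 1) = x n - 1 then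
    Set.Ici (p ((dirLocP x n (x n) : ℤ) - dirLocM x n (x n)))
  else ∅

theorem measurableSet_stepSet (p : ℤ → ℝ) (x : ℕ → ℤ) (n : ℕ) : MeasurableSet (stepSet p x n) := by
  unfold stepSet
  split_ifs
  · exact measurableSet_Iio
  · exact measurableSet_Ici
  · exact MeasurableSet.empty

theorem unif_stepSet {w : ℤ → ℝ} (hw : GoodWeight w) (x : ℕ → ℤ) (n : ℕ) :
    unif (stepSet (rightProb w) x n) = ENNReal.ofReal (stepProb w x n) := by
  have hp := GoodWeight.repelling hw
  simp only [stepSet, stepProb]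
  generalize (dirLocP x n (x n) : ℤ) - dirLocM x n (x n) = z
  split_ifs
  · rw [unif_Iio (hp.lt_one z).le, rightProb]
  · rw [unif_Ici (hp.pos z).le (hp.lt_one z).le, ← hp.neg, rightProb, neg_neg, add_comm]
  · simp

theorem stackWalk_cylinder (p : ℤ → ℝ) (x : ℕ → ℤ) (hx : x 0 = 0) (n : ℕ) :
    {U | ∀ i ≤ n, stackWalk p U i = x i} =
      ⋂ i ∈ Finset.range n, (fun U : ℤ → ℕ → ℝ => U (x i) (visits x i (x i))) ⁻¹'
        stepSet p x i := by
  induction n with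
  | zero =>
    ext U
    simp [hx, stackWalk, stackState]
  | succ n ih =>
    rw [Finset.range_add_one, Finset.set_biInter_insert, ← ih]
    ext U
    simp only [Set.mem_ofPred_eq, Set.mem_inter_iff, Set.mem_preimage]
    have h1 : (∀ i ≤ n + 1, stackWalk p U i = x i) ↔
        (∀ i ≤ n, stackWalk p U i = x i) ∧ stackWalk p U (n + 1) = x (n + 1) :=
      ⟨fun h => ⟨fun i hi => h i (by omega), h _ le_rfl⟩, fun h i hi => by
        rcases Nat.lt_or_ge n i with h' | h'
        · rw [show i = n + 1 by omega]; exact h.2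
        · exact h.1 i h'⟩
    rw [h1, and_comm]
    refine and_congr_left fun h => ?_
    rw [stackWalk_succ, dirLocP_congr h, dirLocM_congr h, visits_congr (fun i hi => h i hi.le),
      h n le_rfl, stepSet]
    generalize p ((dirLocP x n (x n) : ℤ) - dirLocM x n (x n)) = t
    generalize U (x n) (visits x n (x n)) = u
    have hmem : (u ∈ if x (n + 1) = x n + 1 then Set.Iio t else
        if x (n + 1) = x n - 1 then Set.Ici t else ∅) ↔
        (x (n + 1) = x n + 1 ∧ u < t) ∨ (x (n + 1) = x n - 1 ∧ t ≤ u) := by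
      split_ifs with h2 h3
      · simp [h2]; omega
      · simp [h3]; omega
      · simp [h2, h3]
    rw [hmem]
    split_ifs with h2
    · simp only [h2, not_le.2 h2, and_true, and_false, or_false]
      omega
    · simp only [h2, not_lt.1 h2, and_true, and_false, false_or]
      omega

/-- The law of the independent stacks of uniform variables. -/
def stackMeasure : Measure (ℤ → ℕ → ℝ) := Measure.infinitePi fun _ => siteMeasure

instance : IsProbabilityMeasure stackMeasure := by unfold stackMeasure; infer_instance

theorem measurePreserving_site (k : ℤ) :
    MeasurePreserving (fun U : ℤ → ℕ → ℝ => U k) stackMeasure siteMeasure :=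
  measurePreserving_eval_infinitePi _ k

theorem iIndepFun_stack :
    iIndepFun (fun (q : ℤ × ℕ) (U : ℤ → ℕ → ℝ) => U q.1 q.2) stackMeasure :=
  iIndepFun_uncurry_infinitePi' (X := fun _ _ u => u) (fun _ _ => unif) fun _ _ => measurable_id

theorem stackMeasure_map (k : ℤ) (m : ℕ) : stackMeasure.map (fun U => U k m) = unif := by
  have h := (measurePreserving_site k).map_eq
  rw [← siteMeasure_map_eval m, ← h, Measure.map_map (measurable_pi_apply m)
    (measurable_pi_apply k)]
  rfl

theorem measurableSet_stackWalk_cylinder (p : ℤ → ℝ) (x : ℕ → ℤ) (n : ℕ) :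
    MeasurableSet {U | ∀ i ≤ n, stackWalk p U i = x i} := by
  by_cases hx : x 0 = 0
  · rw [stackWalk_cylinder p x hx]
    refine Finset.measurableSet_biInter _ fun i _ => ?_
    exact measurable_pi_iff.1 (measurable_pi_apply (x i)) _ (measurableSet_stepSet p x i)
  · convert MeasurableSet.empty
    ext U
    simp only [Set.mem_ofPred_eq, Set.mem_empty_iff_false, iff_false]
    exact fun h => hx (h 0 (Nat.zero_le _)).symm

theorem stackMeasure_cylinder {w : ℤ → ℝ} (hw : GoodWeight w) (x : ℕ → ℤ) (hx : x 0 = 0)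
    (n : ℕ) : stackMeasure {U | ∀ i ≤ n, stackWalk (rightProb w) U i = x i} =
      ∏ i ∈ Finset.range n, ENNReal.ofReal (stepProb w x i) := by
  rw [stackWalk_cylinder _ x hx]
  have h := (iIndepFun_stack.precomp (injective_visits x)).measure_inter_preimage_eq_mul
    (Finset.range n) (sets := stepSet (rightProb w) x) fun i _ => measurableSet_stepSet _ x i
  refine h.trans (Finset.prod_congr rfl fun i _ => ?_)
  have hm : Measurable fun U : ℤ → ℕ → ℝ => U (x i) (visits x i (x i)) :=
    measurable_pi_iff.1 (measurable_pi_apply (x i)) _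
  rw [← unif_stepSet hw, ← stackMeasure_map (x i) (visits x i (x i)),
    Measure.map_apply hm (measurableSet_stepSet _ x i)]

theorem IsSRW.cylinder {Ω : Type*} [MeasurableSpace Ω] {μ : Measure Ω} {w : ℤ → ℝ}
    {X : ℕ → Ω → ℤ} (hX : IsSRW μ w X) (x : ℕ → ℤ) (hx : x 0 = 0) (n : ℕ) :
    μ {ω | ∀ i ≤ n, X i ω = x i} = ∏ i ∈ Finset.range n, ENNReal.ofReal (stepProb w x i) := by
  induction n with
  | zero =>
    simp only [Nat.le_zero, forall_eq, Finset.range_zero, Finset.prod_empty, hx]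
    exact hX.2.1
  | succ n ih => rw [hX.2.2, ih, Finset.prod_range_succ]

/-- Cylinder sets of integer paths. -/
def pathCylinders : Set (Set (ℕ → ℤ)) := {s | ∃ (n : ℕ) (x : ℕ → ℤ), s = {z | ∀ i ≤ n, z i = x i}}

theorem isPiSystem_pathCylinders : IsPiSystem pathCylinders := by
  rintro _ ⟨n, x, rfl⟩ _ ⟨m, y, rfl⟩ ⟨z, hz1, hz2⟩
  simp only [Set.mem_ofPred_eq] at hz1 hz2
  refine ⟨max n m, z, ?_⟩
  ext z'
  simp only [Set.mem_inter_iff, Set.mem_ofPred_eq]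
  constructor
  · rintro ⟨h1, h2⟩ i hi
    rcases le_max_iff.1 hi with h | h
    · rw [h1 i h, hz1 i h]
    · rw [h2 i h, hz2 i h]
  · exact fun h => ⟨fun i hi => by rw [h i (hi.trans (le_max_left _ _)), hz1 i hi],
      fun i hi => by rw [h i (hi.trans (le_max_right _ _)), hz2 i hi]⟩

theorem generateFrom_pathCylinders :
    (MeasurableSpace.pi : MeasurableSpace (ℕ → ℤ)) = MeasurableSpace.generateFrom pathCylinders := by
  refine le_antisymm ?_ (MeasurableSpace.generateFrom_le ?_)
  · have h : ∀ n, @Measurable _ _ (MeasurableSpace.generateFrom pathCylinders) _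
        (fun z : ℕ → ℤ => z n) := by
      intro n
      refine @measurable_to_countable' ℤ (ℕ → ℤ) _ _ (MeasurableSpace.generateFrom pathCylinders) _ ?_
      intro y
      have h1 : (fun z : ℕ → ℤ => z n) ⁻¹' {y} = ⋃ x : {x : ℕ →₀ ℤ // x n = y},
          {z : ℕ → ℤ | ∀ i ≤ n, z i = x.1 i} := by
        ext z
        simp only [Set.mem_preimage, Set.mem_singleton_iff, Set.mem_iUnion, Set.mem_ofPred_eq]
        constructor
        · intro h
          let x : ℕ →₀ ℤ := ∑ i ∈ Finset.range (n + 1), Finsupp.single i (z i)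
          have hx : ∀ i ≤ n, z i = x i := fun i hi => by
            simp only [x, Finsupp.finsetSum_apply, Finsupp.single_apply]
            rw [Finset.sum_ite_eq', if_pos (Finset.mem_range.2 (by omega))]
          exact ⟨⟨x, by rw [← hx n le_rfl, h]⟩, hx⟩
        · rintro ⟨x, hx⟩
          rw [hx n le_rfl, x.2]
      rw [h1]
      refine @MeasurableSet.iUnion _ _ (MeasurableSpace.generateFrom pathCylinders) _ _ ?_
      exact fun x => MeasurableSpace.measurableSet_generateFrom ⟨n, x.1, rfl⟩
    have h2 := @measurable_pi_lambda (ℕ → ℤ) ℕ (fun _ => ℤ)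
      (MeasurableSpace.generateFrom pathCylinders) _ (fun z => z) h
    exact fun s hs => h2 hs
  · rintro _ ⟨n, x, rfl⟩
    have h : {z : ℕ → ℤ | ∀ i ≤ n, z i = x i} =
        ⋂ i ∈ Finset.range (n + 1), (fun z : ℕ → ℤ => z i) ⁻¹' {x i} := by
      ext z
      simp
    rw [h]
    exact Finset.measurableSet_biInter _ fun i _ =>
      (measurable_pi_apply i : Measurable fun z : ℕ → ℤ => z i) (measurableSet_singleton (x i))

theorem measurable_stackWalk (p : ℤ → ℝ) : Measurable (stackWalk p) := by
  rw [generateFrom_pathCylinders]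
  refine measurable_generateFrom ?_
  rintro _ ⟨n, x, rfl⟩
  exact measurableSet_stackWalk_cylinder p x n

theorem IsSRW.map_eq {Ω : Type*} [MeasurableSpace Ω] {μ : Measure Ω} [IsProbabilityMeasure μ]
    {w : ℤ → ℝ} (hw : GoodWeight w) {X : ℕ → Ω → ℤ} (hX : IsSRW μ w X) :
    μ.map (fun ω i => X i ω) = stackMeasure.map (stackWalk (rightProb w)) := by
  have hXm : Measurable fun ω i => X i ω := measurable_pi_lambda _ hX.1
  have hWm := measurable_stackWalk (rightProb w)
  have := Measure.isProbabilityMeasure_map (μ := μ) hXm.aemeasurable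
  refine ext_of_generate_finite _ generateFrom_pathCylinders isPiSystem_pathCylinders ?_ ?_
  · rintro s ⟨n, x, rfl⟩
    have hs : MeasurableSet {z : ℕ → ℤ | ∀ i ≤ n, z i = x i} := by
      rw [generateFrom_pathCylinders]
      exact MeasurableSpace.measurableSet_generateFrom ⟨n, x, rfl⟩
    rw [Measure.map_apply hXm hs, Measure.map_apply hWm hs]
    simp only [Set.preimage_ofPred_eq]
    by_cases hx : x 0 = 0
    · rw [IsSRW.cylinder hX x hx, stackMeasure_cylinder hw x hx]
    · have h1 : {U | ∀ i ≤ n, stackWalk (rightProb w) U i = x i} = ∅ := by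
        ext U
        simp only [Set.mem_ofPred_eq, Set.mem_empty_iff_false, iff_false]
        exact fun h => hx (h 0 (Nat.zero_le _)).symm
      rw [h1, measure_empty]
      refine measure_mono_null (t := {ω | X 0 ω = 0}ᶜ) (fun ω hω h => ?_) ?_
      · exact hx ((hω 0 (Nat.zero_le _)).symm.trans h)
      · exact (prob_compl_eq_zero_iff (hX.1 0 (measurableSet_singleton 0))).2 hX.2.1
  · rw [Measure.map_apply hXm MeasurableSet.univ, Measure.map_apply hWm MeasurableSet.univ]
    simp

/-- The edge local times at an inverse local time stay within `d` of the triangular profile. -/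
def ProfileClose (j : ℤ) (r : ℕ) (d : ℝ) (z : ℕ → ℤ) : Prop :=
  ∀ k : ℤ, |(LamP z j r k : ℝ) - max (|(j : ℝ)| - |(k : ℝ)| + 2 * r) 0| ≤ d

theorem measurable_dirLocP (n : ℕ) (k : ℤ) : Measurable fun z : ℕ → ℤ => dirLocP z n k := by
  induction n with
  | zero => exact measurable_const
  | succ n ih =>
    simp only [dirLocP_succ]
    refine ih.add (Measurable.ite ?_ measurable_const measurable_const)
    have h : ∀ i : ℕ, Measurable fun z : ℕ → ℤ => z i := measurable_pi_apply
    exact (h n (measurableSet_singleton k)).inter (h (n + 1) (measurableSet_singleton (k + 1)))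

theorem measurable_dirLocM (n : ℕ) (k : ℤ) : Measurable fun z : ℕ → ℤ => dirLocM z n k := by
  induction n with
  | zero => exact measurable_const
  | succ n ih =>
    simp only [dirLocM_succ]
    refine ih.add (Measurable.ite ?_ measurable_const measurable_const)
    have h : ∀ i : ℕ, Measurable fun z : ℕ → ℤ => z i := measurable_pi_apply
    exact (h n (measurableSet_singleton k)).inter (h (n + 1) (measurableSet_singleton (k - 1)))

theorem measurable_LamP (j : ℤ) (r : ℕ) (k : ℤ) : Measurable fun z : ℕ → ℤ => LamP z j r k := by
  have hT : Measurable fun z : ℕ → ℤ => Tp z j r :=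
    measurable_sInf_nat fun m => measurableSet_le measurable_const (measurable_dirLocP m j)
  exact (measurable_eval_nat hT (measurable_pi_lambda _ fun n => measurable_dirLocP n k)).add
    (measurable_eval_nat hT (measurable_pi_lambda _ fun n => measurable_dirLocM n (k + 1)))

theorem measurableSet_not_profileClose (j : ℤ) (r : ℕ) (d : ℝ) :
    MeasurableSet {z | ¬ ProfileClose j r d z} := by
  refine MeasurableSet.compl (s := {z | ProfileClose j r d z}) ?_
  have h : {z | ProfileClose j r d z} = ⋂ k : ℤ,
      {z | |(LamP z j r k : ℝ) - max (|(j : ℝ)| - |(k : ℝ)| + 2 * r) 0| ≤ d} := by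
    ext z
    simp [ProfileClose]
  rw [h]
  refine MeasurableSet.iInter fun k => ?_
  exact (measurable_of_countable fun l : ℕ =>
    |(l : ℝ) - max (|(j : ℝ)| - |(k : ℝ)| + 2 * r) 0|).comp (measurable_LamP j r k)
      measurableSet_Iic

theorem chainLaw_stack {p : ℤ → ℝ} {θ C : ℝ} {e c₀ : ℕ → ℝ} {c : (ℕ → ℝ) → ℕ → ℕ}
    (hc : SiteCount p c) (hQ : SiteLaw siteMeasure θ C e c₀ fun v => other (c v)) {g : ℕ → ℤ}
    (hg : Function.Injective g) :
    ChainLaw stackMeasure θ C e c₀ fun i U => other (c (U (g i))) where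
  indep := (iIndepFun_infinitePi (P := fun _ : ℤ => siteMeasure) (X := fun _ v => other (c v))
    fun _ => hc.measurable_other).precomp hg
  site i := hQ.comp (measurePreserving_site (g i))

theorem ae_unbounded_stack {p : ℤ → ℝ} (hp : Repelling p) {c : (ℕ → ℝ) → ℕ → ℕ}
    (hc : SiteCount p c) : ∀ᵐ U ∂stackMeasure, ∀ k n, ∃ m, n ≤ c (U k) m :=
  ae_all_iff.2 fun k => (measurePreserving_site k).quasiMeasurePreserving.ae
    (SiteCount.ae_unbounded hp hc)

theorem exists_prob_stackWalk_le {p : ℤ → ℝ} (hp : Repelling p) {M ε η : ℝ} (hM : 0 < M)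
    (hε : 0 < ε) (hη : 0 < η) :
    ∃ A₀ : ℝ, ∀ A ≥ A₀, ∀ (j : ℤ) (r : ℕ), 1 ≤ r → |(j : ℝ)| ≤ M * A → (r : ℝ) ≤ M * A →
      stackMeasure {U | ¬ ProfileClose j r (2 * (ε * A) + 4) (stackWalk p U)} ≤
        ENNReal.ofReal η := by
  obtain ⟨θ, hθ, C, hC, e, c₀, he, het, hc₀, hlaw⟩ := exists_siteLaw hp
  obtain ⟨A₁, hA₁⟩ := exists_prob_not_chainClose_le stackMeasure hθ hC he het hc₀
    (show 0 < M + 1 by linarith) hε (half_pos hη)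
  refine ⟨max 1 A₁, fun A hA j r hr hj hrA => ?_⟩
  have hA1 : 1 ≤ A := (le_max_left _ _).trans hA
  have hl := siteCount_left p
  have hrt := siteCount_right hp
  have hMA : (M + 1) * A = M * A + A := by ring
  have hj' := abs_le.1 hj
  have h1 := hA₁ A ((le_max_right _ _).trans hA) _
    (chainLaw_stack hl (hlaw _ hl) (g := fun i : ℕ => j + 1 + i) fun a b h => by simpa using h)
    (r - 1) (-j).toNat (by
      have : ((r - 1 : ℕ) : ℝ) ≤ r := by exact_mod_cast Nat.sub_le _ _
      linarith) (by
      rcases le_total 0 j with h | h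
      · rw [Int.toNat_of_nonpos (by omega), Nat.cast_zero]
        nlinarith
      · have : (((-j).toNat : ℤ) : ℝ) = ((-j : ℤ) : ℝ) := by rw [Int.toNat_of_nonneg (by omega)]
        push_cast at this
        linarith)
  have h2 := hA₁ A ((le_max_right _ _).trans hA) _
    (chainLaw_stack hrt (hlaw _ hrt) (g := fun i : ℕ => j - i) fun a b h => by simpa using h)
    (leftStart j r) (j + 1).toNat (by
      have : (leftStart j r : ℝ) ≤ r := by exact_mod_cast Nat.sub_le _ _
      linarith) (by
      rcases le_total (j + 1) 0 with h | h
      · rw [Int.toNat_of_nonpos h, Nat.cast_zero]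
        nlinarith
      · have : (((j + 1).toNat : ℤ) : ℝ) = ((j + 1 : ℤ) : ℝ) := by rw [Int.toNat_of_nonneg h]
        push_cast at this
        linarith)
  have h3 : stackMeasure {U | ¬ ∀ k n, ∃ m, n ≤ leftCount p (U k) m} = 0 :=
    ae_iff.1 (ae_unbounded_stack hp hl)
  have h4 : stackMeasure {U | ¬ ∀ k n, ∃ m, n ≤ rightCount p (U k) m} = 0 :=
    ae_iff.1 (ae_unbounded_stack hp hrt)
  refine (measure_mono (t := ({U | ¬ ∀ k n, ∃ m, n ≤ leftCount p (U k) m} ∪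
    {U | ¬ ∀ k n, ∃ m, n ≤ rightCount p (U k) m}) ∪
    ({U | ¬ ChainClose (fun i => other (leftCount p (U (j + 1 + i)))) (r - 1) (-j).toNat (ε * A)} ∪
    {U | ¬ ChainClose (fun i => other (rightCount p (U (j - i)))) (leftStart j r) (j + 1).toNat
      (ε * A)})) fun U hU => ?_).trans ?_
  · by_contra hcon
    simp only [Set.mem_union, Set.mem_ofPred_eq, not_or, not_not] at hcon
    obtain ⟨⟨hL, hR⟩, hcL, hcR⟩ := hcon
    exact hU fun k => (stackPath_stackWalk hR hL).abs_LamP_sub_le hr hcL hcR k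
  · refine (measure_union_le _ _).trans ?_
    rw [measure_union_null h3 h4, zero_add]
    refine (measure_union_le _ _).trans ((add_le_add h1 h2).trans ?_)
    rw [← ENNReal.ofReal_add (by positivity) (by positivity), add_halves]

theorem IsSRW.prob_not_profileClose {Ω : Type*} [MeasurableSpace Ω] {μ : Measure Ω}
    [IsProbabilityMeasure μ] {w : ℤ → ℝ} (hw : GoodWeight w) {X : ℕ → Ω → ℤ} (hX : IsSRW μ w X)
    (j : ℤ) (r : ℕ) (d : ℝ) : μ {ω | ¬ ProfileClose j r d fun i => X i ω} =
      stackMeasure {U | ¬ ProfileClose j r d (stackWalk (rightProb w) U)} := by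
  have h := congrArg (fun ν => ν {z | ¬ ProfileClose j r d z}) (IsSRW.map_eq hw hX)
  rwa [Measure.map_apply (measurable_pi_lambda _ hX.1) (measurableSet_not_profileClose j r d),
    Measure.map_apply (measurable_stackWalk _) (measurableSet_not_profileClose j r d)] at h

theorem abs_max_sub_max_zero_le (a b : ℝ) : |max a 0 - max b 0| ≤ |a - b| :=
  abs_max_sub_max_le_abs a b 0

theorem IsSRW.tendsto_LamP {Ω : Type*} [MeasurableSpace Ω] {μ : Measure Ω}
    [IsProbabilityMeasure μ] {w : ℤ → ℝ} (hw : GoodWeight w) {X : ℕ → Ω → ℤ} (hX : IsSRW μ w X)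
    {x h : ℝ} (hh : 0 < h) {j : ℝ → ℤ} {k : ℝ → ℝ → ℤ}
    (hj : ∀ A, |(|(j A : ℝ)| - |A * x|)| ≤ 1) (hk : ∀ A y, |(|(k A y : ℝ)| - |A * y|)| ≤ 2)
    {ε : ℝ} (hε : 0 < ε) :
    Tendsto (fun A : ℝ => μ {ω | ∃ y : ℝ,
      ε < |A⁻¹ * (LamP (fun i => X i ω) (j A) (⌊A * h⌋).toNat (k A y) : ℝ) -
        max (|x| - |y| + 2 * h) 0|}) atTop (𝓝 0) := by
  rw [ENNReal.tendsto_nhds_zero]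
  intro η hη
  obtain ⟨η', hη'0, hη'⟩ : ∃ η' : ℝ, 0 < η' ∧ ENNReal.ofReal η' ≤ η := by
    rcases eq_or_ne η ⊤ with rfl | ht
    · exact ⟨1, one_pos, le_top⟩
    · exact ⟨η.toReal, ENNReal.toReal_pos hη.ne' ht, (ENNReal.ofReal_toReal ht).le⟩
  obtain ⟨A₁, hA₁⟩ := exists_prob_stackWalk_le (GoodWeight.repelling hw)
    (show 0 < |x| + h + 1 by positivity) (show 0 < ε / 4 by positivity) hη'0
  filter_upwards [eventually_ge_atTop A₁, eventually_ge_atTop 1, eventually_ge_atTop (h⁻¹),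
    eventually_ge_atTop (18 / ε)] with A h1 h2 h3 h4
  have hA0 : 0 < A := by linarith
  have hAh : 1 ≤ A * h := by rwa [inv_le_iff_one_le_mul₀ hh] at h3
  have hfl : 1 ≤ ⌊A * h⌋ := Int.le_floor.2 (by simpa using hAh)
  have hr1 : 1 ≤ (⌊A * h⌋).toNat := by omega
  have hr : (((⌊A * h⌋).toNat : ℕ) : ℝ) = ⌊A * h⌋ := by
    exact_mod_cast Int.toNat_of_nonneg (by omega : 0 ≤ ⌊A * h⌋)
  have hr2 : (((⌊A * h⌋).toNat : ℕ) : ℝ) ≤ A * h := hr ▸ Int.floor_le _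
  have hr3 : A * h - 1 < (((⌊A * h⌋).toNat : ℕ) : ℝ) := hr ▸ Int.sub_one_lt_floor _
  have hj1 := abs_le.1 (hj A)
  have habs : ∀ t : ℝ, |A * t| = A * |t| := fun t => by rw [abs_mul, abs_of_pos hA0]
  rw [habs] at hj1
  have hx0 := mul_nonneg hA0.le (abs_nonneg x)
  have hM : (|x| + h + 1) * A = A * |x| + A * h + A := by ring
  have hb := hA₁ A h1 (j A) (⌊A * h⌋).toNat hr1 (by linarith) (by linarith)
  rw [← IsSRW.prob_not_profileClose hw hX] at hb
  refine (measure_mono fun ω hω hcl => ?_).trans (hb.trans hη')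
  obtain ⟨y, hy⟩ := hω
  refine absurd hy (not_lt.2 ?_)
  have hy1 := abs_le.1 (hk A y)
  rw [habs] at hy1
  have hcl' := abs_le.1 (hcl (k A y))
  have hmax := abs_le.1 ((abs_max_sub_max_zero_le (|(j A : ℝ)| - |(k A y : ℝ)| +
    2 * (((⌊A * h⌋).toNat : ℕ) : ℝ)) (A * (|x| - |y| + 2 * h))).trans
    (show _ ≤ (5 : ℝ) by rw [abs_le]; constructor <;> linarith))
  have hmul : max (A * (|x| - |y| + 2 * h)) 0 = A * max (|x| - |y| + 2 * h) 0 := by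
    rw [mul_max_of_nonneg _ _ hA0.le, mul_zero]
  rw [hmul] at hmax
  rw [div_le_iff₀ hε] at h4
  have hfac : A⁻¹ * (LamP (fun i => X i ω) (j A) (⌊A * h⌋).toNat (k A y) : ℝ) -
      max (|x| - |y| + 2 * h) 0 =
      A⁻¹ * ((LamP (fun i => X i ω) (j A) (⌊A * h⌋).toNat (k A y) : ℝ) -
        A * max (|x| - |y| + 2 * h) 0) := by
    field_simp
  rw [hfac, abs_mul, abs_of_pos (inv_pos.2 hA0), inv_mul_le_iff₀ hA0, abs_le]
  constructor <;> linarith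

section Reflection

theorem dirLocP_neg (x : ℕ → ℤ) (n : ℕ) (k : ℤ) :
    dirLocP (fun i => -x i) n k = dirLocM x n (-k) := by
  unfold dirLocP dirLocM
  congr 1
  exact Finset.filter_congr fun i _ => by dsimp only; omega

theorem dirLocM_neg (x : ℕ → ℤ) (n : ℕ) (k : ℤ) :
    dirLocM (fun i => -x i) n k = dirLocP x n (-k) := by
  unfold dirLocP dirLocM
  congr 1
  exact Finset.filter_congr fun i _ => by dsimp only; omega

theorem stepProb_neg (w : ℤ → ℝ) (x : ℕ → ℤ) (n : ℕ) :
    stepProb w (fun i => -x i) n = stepProb w x n := by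
  simp only [stepProb, dirLocP_neg, dirLocM_neg, neg_neg]
  generalize hP : (dirLocP x n (x n) : ℤ) = P
  generalize hM : (dirLocM x n (x n) : ℤ) = M
  rw [neg_sub, neg_sub, add_comm (w (M - P))]
  split_ifs <;> first | rfl | omega

theorem LamM_eq_LamP_neg (x : ℕ → ℤ) (j : ℤ) (r : ℕ) (k : ℤ) :
    LamM x j r k = LamP (fun i => -x i) (-j) r (-k - 1) := by
  simp only [LamM, LamP, Tm, Tp, dirLocP_neg, dirLocM_neg, neg_neg]
  rw [add_comm]
  congr 2 <;> ring

theorem IsSRW.neg {Ω : Type*} [MeasurableSpace Ω] {μ : Measure Ω} {w : ℤ → ℝ} {X : ℕ → Ω → ℤ}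
    (hX : IsSRW μ w X) : IsSRW μ w fun i ω => -X i ω := by
  refine ⟨fun n => (hX.1 n).neg, by simpa using hX.2.1, fun n x => ?_⟩
  have h := hX.2.2 n fun i => -x i
  rw [stepProb_neg] at h
  simpa only [neg_eq_iff_eq_neg] using h

end Reflection

theorem abs_abs_floor_sub_le (t : ℝ) : |(|(⌊t⌋ : ℝ)| - |t|)| ≤ 1 := by
  refine (abs_abs_sub_abs_le _ _).trans ?_
  rw [abs_le]
  constructor <;> linarith [Int.floor_le t, Int.lt_floor_add_one t]

end SelfRepelling

/-- as `A → ∞`,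
`sup_{y ∈ ℝ} |A⁻¹ Λ±_{⌊Ax⌋,⌊Ah⌋}(⌊Ay⌋) - (|x| - |y| + 2h)₊| → 0` in probability. -/
theorem stmt_15 (w : ℤ → ℝ) (hw : GoodWeight w)
    {Ω : Type*} [MeasurableSpace Ω] (μ : Measure Ω) [IsProbabilityMeasure μ]
    (X : ℕ → Ω → ℤ) (hX : IsSRW μ w X) (x h : ℝ) (hh : 0 < h) :
    ∀ ε > (0 : ℝ),
      Tendsto (fun A : ℝ => μ {ω | ∃ y : ℝ,
          ε < |A⁻¹ * (LamP (fun i => X i ω) ⌊A * x⌋ (⌊A * h⌋).toNat ⌊A * y⌋ : ℝ) -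
            max (|x| - |y| + 2 * h) 0|}) atTop (𝓝 0) ∧
      Tendsto (fun A : ℝ => μ {ω | ∃ y : ℝ,
          ε < |A⁻¹ * (LamM (fun i => X i ω) ⌊A * x⌋ (⌊A * h⌋).toNat ⌊A * y⌋ : ℝ) -
            max (|x| - |y| + 2 * h) 0|}) atTop (𝓝 0) := by
  intro ε hε
  refine ⟨SelfRepelling.IsSRW.tendsto_LamP hw hX hh
    (fun A => SelfRepelling.abs_abs_floor_sub_le _)
    (fun A y => (SelfRepelling.abs_abs_floor_sub_le _).trans one_le_two) hε, ?_⟩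
  simp only [SelfRepelling.LamM_eq_LamP_neg]
  refine SelfRepelling.IsSRW.tendsto_LamP hw (SelfRepelling.IsSRW.neg hX) hh
    (j := fun A => -⌊A * x⌋) (k := fun A y => -⌊A * y⌋ - 1) (fun A => ?_) (fun A y => ?_) hε
  · rw [Int.cast_neg, abs_neg]
    exact SelfRepelling.abs_abs_floor_sub_le _
  · rw [← neg_add', Int.cast_neg, abs_neg]
    refine (abs_abs_sub_abs_le _ _).trans ?_
    push_cast
    rw [abs_le]
    constructor <;> linarith [Int.floor_le (A * y), Int.lt_floor_add_one (A * y)]
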